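/- arXiv:2601.23213 — 3 statements merged into one kernel-verified Lean document; each statement's English description precedes it below -/
import Mathlib

section
/- Let ‖P‖ denote the sum of all entries of a nonnegative matrix P. Let Δ assign to every matrix with nonnegative real entries (of every finite size) a real number such that: (i) Δ is invariant under permuting rows and columns and under adding or removing zero rows and columns; (ii) Δ(P ⊕ Q) = Δ(P) + Δ(Q) for direct sums; (iii) the Leibniz rule Δ(P ⊗ Q) = Δ(P)·‖Q‖ + ‖P‖·Δ(Q) holds for Kronecker products; (iv) Δ((c)) = 0 for every 1×1 matrix (c) with c ≥ 0; (v) Δ(P) ≤ Δ(Q) whenever Q is obtained from P by a conditionally mixing channel. Then there exists a finite positive Borel measure τ on [0,∞] such that for every matrix P with nonnegative entries, Δ(P) = ∑_{y: P_Y(y)>0} P_Y(y)·∫_{[0,∞]} H_α(P_{X|Y=y}) dτ(α), where P_Y(y) denotes the y-th column sum and P_{X|Y=y} the normalized y-th column; moreover, if additionally Δ((1/2,1/2)) = 1, then τ is a probability measure. -/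
open MeasureTheory
open scoped ENNReal

noncomputable section

/-- Base-2 logarithm. -/
def log2 (x : ℝ) : ℝ := Real.logb 2 x

/-- Base-2 exponential. -/
def exp2 (x : ℝ) : ℝ := (2 : ℝ) ^ x

/-- Rényi entropy of order `α ∈ [0,∞]` of a vector `p` on a finite set. -/
def renyi {X : Type*} [Fintype X] (α : ℝ≥0∞) (p : X → ℝ) : ℝ :=
  if α = 0 then log2 (Nat.card {x : X // 0 < p x})
  else if α = 1 then -∑ x, p x * log2 (p x)
  else if α = ⊤ then -log2 (⨆ x, p x)
  else (1 - α.toReal)⁻¹ * log2 (∑ x, p x ^ α.toReal)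

/-- A probability vector on a finite set. -/
def IsProbVec {X : Type*} [Fintype X] (p : X → ℝ) : Prop :=
  (∀ x, 0 ≤ p x) ∧ ∑ x, p x = 1

/-- A doubly stochastic matrix. -/
def DoublyStochastic {X : Type*} [Fintype X] (S : Matrix X X ℝ) : Prop :=
  (∀ i j, 0 ≤ S i j) ∧ (∀ i, ∑ j, S i j = 1) ∧ (∀ j, ∑ i, S i j = 1)

/-- `Q` is obtained from `P` by a conditionally mixing channel. -/
def CondMixed {X Y Y' : Type*} [Fintype X] [Fintype Y] [Fintype Y']
    (P : Matrix X Y ℝ) (Q : Matrix X Y' ℝ) : Prop :=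
  ∃ (k : ℕ) (S : Fin k → Matrix X X ℝ) (D : Fin k → Matrix Y Y' ℝ),
    (∀ i, DoublyStochastic (S i)) ∧
    (∀ i a b, 0 ≤ D i a b) ∧
    (∀ a, ∑ b, ∑ i, D i a b = 1) ∧
    Q = ∑ i, S i * P * D i

/-- A joint probability distribution on finite alphabets, viewed as a matrix. -/
def IsJointProb {X Y : Type*} [Fintype X] [Fintype Y] (P : Matrix X Y ℝ) : Prop :=
  (∀ x y, 0 ≤ P x y) ∧ ∑ x, ∑ y, P x y = 1

/-- Marginal on the conditioning system: the `y`-th column sum. -/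
def margY {X Y : Type*} [Fintype X] (P : Matrix X Y ℝ) (y : Y) : ℝ := ∑ x, P x y

/-- The conditioned distribution (normalized `y`-th column). -/
def condX {X Y : Type*} [Fintype X] (P : Matrix X Y ℝ) (y : Y) : X → ℝ :=
  fun x => P x y / margY P y

/-- The conditional entropy `H_{t,τ}`. -/
def Hbulk {X Y : Type*} [Fintype X] [Fintype Y] (t : ℝ) (τ : Measure ℝ≥0∞)
    (P : Matrix X Y ℝ) : ℝ :=
  t⁻¹ * log2 (∑ y ∈ Finset.univ.filter (fun y => 0 < margY P y),
    margY P y * exp2 (t * ∫ α, renyi α (condX P y) ∂τ))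

/-- The conditional entropy `H_{0,α}`. -/
def HzeroA {X Y : Type*} [Fintype X] [Fintype Y] (α : ℝ≥0∞) (P : Matrix X Y ℝ) : ℝ :=
  ∑ y ∈ Finset.univ.filter (fun y => 0 < margY P y), margY P y * renyi α (condX P y)

/-- The conditional entropy `H_{-∞,τ}`. -/
def HnegInf {X Y : Type*} [Fintype X] [Fintype Y] (τ : Measure ℝ≥0∞)
    (P : Matrix X Y ℝ) : ℝ :=
  sInf ((fun y => ∫ α, renyi α (condX P y) ∂τ) '' {y | 0 < margY P y})

/-- The conditional entropy `H_{+∞,0}`. -/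
def HposInf {X Y : Type*} [Fintype X] [Fintype Y] (P : Matrix X Y ℝ) : ℝ :=
  sSup ((fun y => renyi 0 (condX P y)) '' {y | 0 < margY P y})

/-- The parameter set `𝒟_bulk`. -/
def Dbulk : Set (ℝ × Measure ℝ≥0∞) :=
  {p | p.1 ≠ 0 ∧ IsProbabilityMeasure p.2 ∧
    ∀ (d n n' : ℕ) (P : Matrix (Fin d) (Fin n) ℝ) (Q : Matrix (Fin d) (Fin n') ℝ),
      IsJointProb P → CondMixed P Q → Hbulk p.1 p.2 P ≤ Hbulk p.1 p.2 Q}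

/-- The parameter set `𝒟_{-∞}`. -/
def DnegInf : Set (Measure ℝ≥0∞) :=
  {τ | IsProbabilityMeasure τ ∧
    ∀ (d n n' : ℕ) (P : Matrix (Fin d) (Fin n) ℝ) (Q : Matrix (Fin d) (Fin n') ℝ),
      IsJointProb P → CondMixed P Q → HnegInf τ P ≤ HnegInf τ Q}

/-- `P'` is obtained from `P` by relabeling (injections) and embedding, with zeros elsewhere. -/
def Embeds {X Y X' Y' : Type*} [Fintype X] [Fintype Y] [Fintype X'] [Fintype Y']
    (P : Matrix X Y ℝ) (P' : Matrix X' Y' ℝ) : Prop :=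
  ∃ (f : X ↪ X') (g : Y ↪ Y'),
    (∀ x y, P' (f x) (g y) = P x y) ∧
    (∀ x' y', P' x' y' ≠ 0 → (∃ x, f x = x') ∧ (∃ y, g y = y'))

/-- Conditional majorization: after a common embedding, a conditionally mixing channel maps
(the embedding of) `P` to (the embedding of) `Q`. -/
def CondMajorizes {X Y X' Y' : Type*} [Fintype X] [Fintype Y] [Fintype X'] [Fintype Y']
    (P : Matrix X Y ℝ) (Q : Matrix X' Y' ℝ) : Prop :=
  ∃ (m n n' : ℕ) (P' : Matrix (Fin m) (Fin n) ℝ) (Q' : Matrix (Fin m) (Fin n') ℝ),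
    Embeds P P' ∧ Embeds Q Q' ∧ CondMixed P' Q'

/-- Kronecker product of matrices. -/
def kron {X Y X' Y' : Type*} (P : Matrix X Y ℝ) (Q : Matrix X' Y' ℝ) :
    Matrix (X × X') (Y × Y') ℝ :=
  Matrix.of fun x y => P x.1 y.1 * Q x.2 y.2

/-- `n`-fold Kronecker power of a matrix. -/
def kronPow {X Y : Type*} (P : Matrix X Y ℝ) (n : ℕ) :
    Matrix (Fin n → X) (Fin n → Y) ℝ :=
  Matrix.of fun x y => ∏ i, P (x i) (y i)

/-- Sum of all entries of a matrix. -/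
def totalMass {X Y : Type*} [Fintype X] [Fintype Y] (P : Matrix X Y ℝ) : ℝ :=
  ∑ x, ∑ y, P x y

/-- `α/(1-α)`, with the convention that it equals `-1` at `α = ∞`. -/
def aRatio (α : ℝ≥0∞) : ℝ := if α = ⊤ then -1 else α.toReal / (1 - α.toReal)

/-- `α/(α-1)`, with the convention that it equals `1` at `α = ∞`. -/
def aRatio' (α : ℝ≥0∞) : ℝ := if α = ⊤ then 1 else α.toReal / (α.toReal - 1)

/-- Rényi relative entropy `D_α(p‖r)`. -/
def relRenyi {X : Type*} [Fintype X] (α : ℝ≥0∞) (p r : X → ℝ) : ℝ :=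
  if α = 1 then ∑ x, p x * log2 (p x / r x)
  else if α = ⊤ then log2 (⨆ x, p x / r x)
  else (α.toReal - 1)⁻¹ * log2 (∑ x, p x ^ α.toReal * r x ^ (1 - α.toReal))

/-- The quantity `I_{t,τ}(P‖R)`. -/
def Ibulk {X Y : Type*} [Fintype X] [Fintype Y] (t : ℝ) (τ : Measure ℝ≥0∞)
    (P : Matrix X Y ℝ) (R : X → ℝ) : ℝ :=
  -t⁻¹ * log2 (∑ y ∈ Finset.univ.filter (fun y => 0 < margY P y),
    margY P y * exp2 (-t * ∫ α, relRenyi α (condX P y) R ∂τ))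

/-- The quantity `I_{-∞,τ}(P‖R)`. -/
def InegInf {X Y : Type*} [Fintype X] [Fintype Y] (τ : Measure ℝ≥0∞)
    (P : Matrix X Y ℝ) (R : X → ℝ) : ℝ :=
  sSup ((fun y => ∫ α, relRenyi α (condX P y) R ∂τ) '' {y | 0 < margY P y})

/-- A conditioned `R`-preserving channel maps `P` to `Q`. -/
def CondPreserving {X Y Y' : Type*} [Fintype X] [Fintype Y] [Fintype Y'] (R : X → ℝ)
    (P : Matrix X Y ℝ) (Q : Matrix X Y' ℝ) : Prop :=
  ∃ (k : ℕ) (G : Fin k → Matrix X X ℝ) (D : Fin k → Matrix Y Y' ℝ),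
    (∀ i a b, 0 ≤ G i a b) ∧
    (∀ i b, ∑ a, G i a b = 1) ∧
    (∀ i, (G i).mulVec R = R) ∧
    (∀ i a b, 0 ≤ D i a b) ∧
    (∀ a, ∑ b, ∑ i, D i a b = 1) ∧
    Q = ∑ i, G i * P * D i

/-- Total variation distance between two matrices. -/
def tvDist {X Y : Type*} [Fintype X] [Fintype Y] (P Q : Matrix X Y ℝ) : ℝ :=
  (1 / 2) * ∑ x, ∑ y, |P x y - Q x y|

/-! ### Part 1: from `Δ` to a functional on nonnegative vectors -/

/-- The properties of the column functional that are used in the sequel. -/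
structure IsH (h : ∀ (X : Type) [Fintype X], (X → ℝ) → ℝ) : Prop where
  emb : ∀ (X X' : Type) [Fintype X] [Fintype X'] (v : X → ℝ) (v' : X' → ℝ) (f : X ↪ X'),
    (∀ x, 0 ≤ v x) → (∀ x, v' (f x) = v x) → (∀ x', v' x' ≠ 0 → ∃ x, f x = x') →
    h X v = h X' v'
  sup : ∀ (X ι : Type) [Fintype X] [Fintype ι] (v : ι → X → ℝ), (∀ i x, 0 ≤ v i x) →
    ∑ i, h X (v i) ≤ h X (fun x => ∑ i, v i x)
  smul : ∀ (X : Type) [Fintype X] (c : ℝ) (v : X → ℝ), 0 ≤ c → (∀ x, 0 ≤ v x) →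
    h X (fun x => c * v x) = c * h X v
  prod : ∀ (X Y : Type) [Fintype X] [Fintype Y] (v : X → ℝ) (w : Y → ℝ),
    (∀ x, 0 ≤ v x) → (∀ y, 0 ≤ w y) →
    h (X × Y) (fun z => v z.1 * w z.2) = h X v * (∑ y, w y) + (∑ x, v x) * h Y w
  nonneg : ∀ (X : Type) [Fintype X] (v : X → ℝ), (∀ x, 0 ≤ v x) → 0 ≤ h X v

lemma condMixed_of_fintype {X Y Y' ι : Type} [Fintype X] [Fintype Y] [Fintype Y'] [Fintype ι]
    (P : Matrix X Y ℝ) (Q : Matrix X Y' ℝ) (S : ι → Matrix X X ℝ) (D : ι → Matrix Y Y' ℝ)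
    (hS : ∀ i, DoublyStochastic (S i)) (hD : ∀ i a b, 0 ≤ D i a b)
    (hD1 : ∀ a, ∑ b, ∑ i, D i a b = 1) (hQ : Q = ∑ i, S i * P * D i) : CondMixed P Q := by
  let e := Fintype.equivFin ι
  refine ⟨Fintype.card ι, fun i => S (e.symm i), fun i => D (e.symm i), fun i => hS _,
    fun i a b => hD _ a b, fun a => ?_, ?_⟩
  · rw [← hD1 a]
    refine Finset.sum_congr rfl fun b _ => ?_
    exact Equiv.sum_comp e.symm (fun i => D i a b)
  · rw [hQ]
    exact (Equiv.sum_comp e.symm (fun i => S i * P * D i)).symm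

lemma doublyStochastic_perm {X : Type} [Fintype X] [DecidableEq X] (σ : Equiv.Perm X) :
    DoublyStochastic (Matrix.of fun i j => if j = σ i then (1 : ℝ) else 0) := by
  refine ⟨fun i j => ?_, fun i => ?_, fun j => ?_⟩
  · simp only [Matrix.of_apply]; split_ifs <;> norm_num
  · simp
  · simp only [Matrix.of_apply]
    rw [← Equiv.sum_comp σ.symm]
    simp

lemma condMixed_perm {X Y : Type} [Fintype X] [Fintype Y]
    (P Q : Matrix X Y ℝ) (σ : Y → Equiv.Perm X) (hQ : ∀ x y, Q x y = P (σ y x) y) :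
    CondMixed P Q := by
  classical
  refine condMixed_of_fintype (ι := Y) P Q
    (fun y => Matrix.of fun i j => if j = σ y i then (1 : ℝ) else 0)
    (fun y => Matrix.of fun a b => if a = y ∧ b = y then (1 : ℝ) else 0)
    (fun y => doublyStochastic_perm _) (fun i a b => ?_) (fun a => ?_) ?_
  · simp only [Matrix.of_apply]; split_ifs <;> norm_num
  · rw [Finset.sum_eq_single a]
    · rw [Finset.sum_eq_single a] <;> simp +contextual [eq_comm]
    · intro b _ hb
      refine Finset.sum_eq_zero fun i _ => ?_
      simp only [Matrix.of_apply]
      rw [if_neg]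
      rintro ⟨h1, h2⟩
      exact hb (h2.trans h1.symm)
    · simp
  · ext x y
    rw [Matrix.sum_apply, Finset.sum_eq_single y]
    · rw [Matrix.mul_apply, Finset.sum_eq_single y]
      · simp [Matrix.mul_apply, hQ]
      · intro b _ hb
        simp [hb]
      · simp
    · intro b _ hb
      rw [Matrix.mul_apply]
      refine Finset.sum_eq_zero fun i _ => ?_
      simp [Ne.symm hb]
    · simp

lemma condMixed_sum {X Y : Type} [Fintype X] [Fintype Y] (P : Matrix X Y ℝ) :
    CondMixed P (Matrix.of fun x (_ : Unit) => ∑ y, P x y) := by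
  classical
  refine condMixed_of_fintype (ι := Unit) P _ (fun _ => 1) (fun _ => Matrix.of fun _ _ => 1)
    (fun _ => ⟨fun i j => ?_, fun i => ?_, fun j => ?_⟩) (fun _ _ _ => by simp) (fun _ => by simp)
    ?_
  · rw [Matrix.one_apply]; split_ifs <;> norm_num
  · simp [Matrix.one_apply]
  · simp [Matrix.one_apply]
  · ext x u
    simp [Matrix.mul_apply]

section FromDelta

/-- The functional `Δ` on single columns. -/
def hcol (Δ : ∀ (X Y : Type) [Fintype X] [Fintype Y], Matrix X Y ℝ → ℝ)
    (X : Type) [Fintype X] (v : X → ℝ) : ℝ :=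
  Δ X Unit (Matrix.of fun x _ => v x)

lemma delta_perm
    (Δ : ∀ (X Y : Type) [Fintype X] [Fintype Y], Matrix X Y ℝ → ℝ)
    (h_mono : ∀ (X Y Y' : Type) [Fintype X] [Fintype Y] [Fintype Y']
      (P : Matrix X Y ℝ) (Q : Matrix X Y' ℝ),
      (∀ x y, 0 ≤ P x y) → CondMixed P Q → Δ X Y P ≤ Δ X Y' Q) {X Y : Type} [Fintype X] [Fintype Y]
    (P Q : Matrix X Y ℝ) (hP : ∀ x y, 0 ≤ P x y) (σ : Y → Equiv.Perm X)
    (hQ : ∀ x y, Q x y = P (σ y x) y) : Δ X Y P = Δ X Y Q := by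
  apply le_antisymm
  · exact h_mono _ _ _ _ _ hP (condMixed_perm P Q σ hQ)
  · refine h_mono _ _ _ _ _ (fun x y => by rw [hQ]; exact hP _ _)
      (condMixed_perm Q P (fun y => (σ y).symm) fun x y => ?_)
    rw [hQ]; simp

lemma delta_option
    (Δ : ∀ (X Y : Type) [Fintype X] [Fintype Y], Matrix X Y ℝ → ℝ)
    (h_inv : ∀ (X Y X' Y' : Type) [Fintype X] [Fintype Y] [Fintype X'] [Fintype Y']
      (P : Matrix X Y ℝ) (P' : Matrix X' Y' ℝ),
      (∀ x y, 0 ≤ P x y) → Embeds P P' → Δ X Y P = Δ X' Y' P')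
    (h_add : ∀ (X Y X' Y' : Type) [Fintype X] [Fintype Y] [Fintype X'] [Fintype Y']
      (P : Matrix X Y ℝ) (Q : Matrix X' Y' ℝ),
      (∀ x y, 0 ≤ P x y) → (∀ x y, 0 ≤ Q x y) →
      Δ (X ⊕ X') (Y ⊕ Y') (Matrix.fromBlocks P 0 0 Q) = Δ X Y P + Δ X' Y' Q)
    (h_mono : ∀ (X Y Y' : Type) [Fintype X] [Fintype Y] [Fintype Y']
      (P : Matrix X Y ℝ) (Q : Matrix X Y' ℝ),
      (∀ x y, 0 ≤ P x y) → CondMixed P Q → Δ X Y P ≤ Δ X Y' Q) {X Y : Type} [Fintype X] [Fintype Y] (P : Matrix X (Unit ⊕ Y) ℝ)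
    (hP : ∀ x y, 0 ≤ P x y) :
    Δ X (Unit ⊕ Y) P = hcol Δ X (fun x => P x (Sum.inl ())) +
      Δ X Y (Matrix.of fun x y => P x (Sum.inr y)) := by
  classical
  unfold hcol
  rw [← h_add _ _ _ _ (Matrix.of fun x (_ : Unit) => P x (Sum.inl ()))
    (Matrix.of fun x y => P x (Sum.inr y)) (fun x y => hP _ _) (fun x y => hP _ _)]
  let P' : Matrix (X ⊕ X) (Unit ⊕ Y) ℝ := Matrix.of fun x y => Sum.elim (fun x => P x y) 0 x
  have h1 : Δ X (Unit ⊕ Y) P = Δ (X ⊕ X) (Unit ⊕ Y) P' := by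
    apply h_inv _ _ _ _ _ _ hP
    refine ⟨⟨Sum.inl, Sum.inl_injective⟩, Function.Embedding.refl _, ?_, ?_⟩
    · intro x y; rfl
    · rintro (x | x) y h
      · exact ⟨⟨x, rfl⟩, ⟨y, rfl⟩⟩
      · simp [P'] at h
  rw [h1]
  refine delta_perm Δ h_mono _ _ ?_
    (fun y => Sum.elim (fun _ => Equiv.refl _) (fun _ => Equiv.sumComm X X) y) ?_
  · rintro (x | x) y
    · exact hP _ _
    · simp [P']
  · rintro (x | x) (y | y) <;> simp [P']

lemma delta_reindex
    (Δ : ∀ (X Y : Type) [Fintype X] [Fintype Y], Matrix X Y ℝ → ℝ)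
    (h_inv : ∀ (X Y X' Y' : Type) [Fintype X] [Fintype Y] [Fintype X'] [Fintype Y']
      (P : Matrix X Y ℝ) (P' : Matrix X' Y' ℝ),
      (∀ x y, 0 ≤ P x y) → Embeds P P' → Δ X Y P = Δ X' Y' P') {X Y X' Y' : Type} [Fintype X] [Fintype Y] [Fintype X'] [Fintype Y']
    (e : X ≃ X') (g : Y ≃ Y') (P : Matrix X Y ℝ) (P' : Matrix X' Y' ℝ)
    (hP : ∀ x y, 0 ≤ P x y) (h : ∀ x y, P' (e x) (g y) = P x y) :
    Δ X Y P = Δ X' Y' P' :=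
  h_inv _ _ _ _ _ _ hP ⟨e.toEmbedding, g.toEmbedding, h, fun x' y' _ =>
    ⟨⟨e.symm x', by simp⟩, ⟨g.symm y', by simp⟩⟩⟩

lemma delta_empty
    (Δ : ∀ (X Y : Type) [Fintype X] [Fintype Y], Matrix X Y ℝ → ℝ)
    (h_inv : ∀ (X Y X' Y' : Type) [Fintype X] [Fintype Y] [Fintype X'] [Fintype Y']
      (P : Matrix X Y ℝ) (P' : Matrix X' Y' ℝ),
      (∀ x y, 0 ≤ P x y) → Embeds P P' → Δ X Y P = Δ X' Y' P')
    (h_scalar : ∀ c : ℝ, 0 ≤ c → Δ (Fin 1) (Fin 1) (Matrix.of fun _ _ => c) = 0) {X : Type} [Fintype X] (P : Matrix X (Fin 0) ℝ) : Δ X (Fin 0) P = 0 := by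
  have a : Δ Empty (Fin 0) 0 = Δ X (Fin 0) P :=
    h_inv _ _ _ _ _ _ (fun x => x.elim) ⟨⟨Empty.elim, fun x => x.elim⟩, Function.Embedding.refl _,
      fun x => x.elim, fun x y => y.elim0⟩
  have b : Δ Empty (Fin 0) 0 = Δ (Fin 1) (Fin 1) (Matrix.of fun _ _ => (0 : ℝ)) :=
    h_inv _ _ _ _ _ _ (fun x => x.elim) ⟨⟨Empty.elim, fun x => x.elim⟩,
      ⟨fun x => x.elim0, fun x => x.elim0⟩,
      fun x => x.elim, fun x y h => by simp at h⟩
  rw [← a, b, h_scalar 0 le_rfl]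

lemma delta_eq_sum
    (Δ : ∀ (X Y : Type) [Fintype X] [Fintype Y], Matrix X Y ℝ → ℝ)
    (h_inv : ∀ (X Y X' Y' : Type) [Fintype X] [Fintype Y] [Fintype X'] [Fintype Y']
      (P : Matrix X Y ℝ) (P' : Matrix X' Y' ℝ),
      (∀ x y, 0 ≤ P x y) → Embeds P P' → Δ X Y P = Δ X' Y' P')
    (h_add : ∀ (X Y X' Y' : Type) [Fintype X] [Fintype Y] [Fintype X'] [Fintype Y']
      (P : Matrix X Y ℝ) (Q : Matrix X' Y' ℝ),
      (∀ x y, 0 ≤ P x y) → (∀ x y, 0 ≤ Q x y) →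
      Δ (X ⊕ X') (Y ⊕ Y') (Matrix.fromBlocks P 0 0 Q) = Δ X Y P + Δ X' Y' Q)
    (h_scalar : ∀ c : ℝ, 0 ≤ c → Δ (Fin 1) (Fin 1) (Matrix.of fun _ _ => c) = 0)
    (h_mono : ∀ (X Y Y' : Type) [Fintype X] [Fintype Y] [Fintype Y']
      (P : Matrix X Y ℝ) (Q : Matrix X Y' ℝ),
      (∀ x y, 0 ≤ P x y) → CondMixed P Q → Δ X Y P ≤ Δ X Y' Q) {X Y : Type} [Fintype X] [Fintype Y] (P : Matrix X Y ℝ)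
    (hP : ∀ x y, 0 ≤ P x y) :
    Δ X Y P = ∑ y, hcol Δ X (fun x => P x y) := by
  have key : ∀ n : ℕ, ∀ P : Matrix X (Fin n) ℝ, (∀ x y, 0 ≤ P x y) →
      Δ X (Fin n) P = ∑ y, hcol Δ X (fun x => P x y) := by
    intro n
    induction n with
    | zero => intro P _; rw [delta_empty Δ h_inv h_scalar]; simp
    | succ n ih =>
      intro P hP
      let g : Unit ⊕ Fin n ≃ Fin (n + 1) :=
        { toFun := Sum.elim (fun _ => 0) Fin.succ
          invFun := Fin.cases (Sum.inl ()) Sum.inr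
          left_inv := by rintro (x | x) <;> simp
          right_inv := by intro x; refine Fin.cases ?_ (fun i => ?_) x <;> simp }
      rw [← delta_reindex Δ h_inv (Equiv.refl X) g (Matrix.of fun x y => P x (g y)) P
        (fun x y => hP _ _) (fun x y => rfl)]
      rw [delta_option Δ h_inv h_add h_mono (Matrix.of fun x y => P x (g y))
        (fun x y => hP _ _), Fin.sum_univ_succ]
      congr 1
      exact ih (fun x y => P x y.succ) (fun x y => hP _ _)
  let e := Fintype.equivFin Y
  rw [delta_reindex Δ h_inv (Equiv.refl X) e P (Matrix.of fun x y => P x (e.symm y)) hP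
    (fun x y => by simp), key _ (Matrix.of fun x y => P x (e.symm y)) (fun x y => hP _ _)]
  exact Equiv.sum_comp e.symm (fun y => hcol Δ X (fun x => P x y))

lemma hcol_emb
    (Δ : ∀ (X Y : Type) [Fintype X] [Fintype Y], Matrix X Y ℝ → ℝ)
    (h_inv : ∀ (X Y X' Y' : Type) [Fintype X] [Fintype Y] [Fintype X'] [Fintype Y']
      (P : Matrix X Y ℝ) (P' : Matrix X' Y' ℝ),
      (∀ x y, 0 ≤ P x y) → Embeds P P' → Δ X Y P = Δ X' Y' P') (X X' : Type) [Fintype X] [Fintype X'] (v : X → ℝ) (v' : X' → ℝ) (f : X ↪ X')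
    (hv : ∀ x, 0 ≤ v x) (h1 : ∀ x, v' (f x) = v x) (h2 : ∀ x', v' x' ≠ 0 → ∃ x, f x = x') :
    hcol Δ X v = hcol Δ X' v' :=
  h_inv _ _ _ _ _ _ (fun x _ => hv x) ⟨f, Function.Embedding.refl _, fun x _ => h1 x,
    fun x' y' h => ⟨h2 x' h, ⟨y', rfl⟩⟩⟩

lemma hcol_sup
    (Δ : ∀ (X Y : Type) [Fintype X] [Fintype Y], Matrix X Y ℝ → ℝ)
    (h_inv : ∀ (X Y X' Y' : Type) [Fintype X] [Fintype Y] [Fintype X'] [Fintype Y']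
      (P : Matrix X Y ℝ) (P' : Matrix X' Y' ℝ),
      (∀ x y, 0 ≤ P x y) → Embeds P P' → Δ X Y P = Δ X' Y' P')
    (h_add : ∀ (X Y X' Y' : Type) [Fintype X] [Fintype Y] [Fintype X'] [Fintype Y']
      (P : Matrix X Y ℝ) (Q : Matrix X' Y' ℝ),
      (∀ x y, 0 ≤ P x y) → (∀ x y, 0 ≤ Q x y) →
      Δ (X ⊕ X') (Y ⊕ Y') (Matrix.fromBlocks P 0 0 Q) = Δ X Y P + Δ X' Y' Q)
    (h_scalar : ∀ c : ℝ, 0 ≤ c → Δ (Fin 1) (Fin 1) (Matrix.of fun _ _ => c) = 0)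
    (h_mono : ∀ (X Y Y' : Type) [Fintype X] [Fintype Y] [Fintype Y']
      (P : Matrix X Y ℝ) (Q : Matrix X Y' ℝ),
      (∀ x y, 0 ≤ P x y) → CondMixed P Q → Δ X Y P ≤ Δ X Y' Q) (X ι : Type) [Fintype X] [Fintype ι] (v : ι → X → ℝ) (hv : ∀ i x, 0 ≤ v i x) :
    ∑ i, hcol Δ X (v i) ≤ hcol Δ X (fun x => ∑ i, v i x) := by
  have := h_mono X ι Unit (Matrix.of fun x i => v i x) _ (fun x i => hv i x) (condMixed_sum _)
  rwa [delta_eq_sum Δ h_inv h_add h_scalar h_mono (Matrix.of fun x i => v i x)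
    (fun x i => hv i x)] at this

lemma hcol_isH
    (Δ : ∀ (X Y : Type) [Fintype X] [Fintype Y], Matrix X Y ℝ → ℝ)
    (h_inv : ∀ (X Y X' Y' : Type) [Fintype X] [Fintype Y] [Fintype X'] [Fintype Y']
      (P : Matrix X Y ℝ) (P' : Matrix X' Y' ℝ),
      (∀ x y, 0 ≤ P x y) → Embeds P P' → Δ X Y P = Δ X' Y' P')
    (h_add : ∀ (X Y X' Y' : Type) [Fintype X] [Fintype Y] [Fintype X'] [Fintype Y']
      (P : Matrix X Y ℝ) (Q : Matrix X' Y' ℝ),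
      (∀ x y, 0 ≤ P x y) → (∀ x y, 0 ≤ Q x y) →
      Δ (X ⊕ X') (Y ⊕ Y') (Matrix.fromBlocks P 0 0 Q) = Δ X Y P + Δ X' Y' Q)
    (h_leibniz : ∀ (X Y X' Y' : Type) [Fintype X] [Fintype Y] [Fintype X'] [Fintype Y']
      (P : Matrix X Y ℝ) (Q : Matrix X' Y' ℝ),
      (∀ x y, 0 ≤ P x y) → (∀ x y, 0 ≤ Q x y) →
      Δ (X × X') (Y × Y') (kron P Q) = Δ X Y P * totalMass Q + totalMass P * Δ X' Y' Q)
    (h_scalar : ∀ c : ℝ, 0 ≤ c → Δ (Fin 1) (Fin 1) (Matrix.of fun _ _ => c) = 0)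
    (h_mono : ∀ (X Y Y' : Type) [Fintype X] [Fintype Y] [Fintype Y']
      (P : Matrix X Y ℝ) (Q : Matrix X Y' ℝ),
      (∀ x y, 0 ≤ P x y) → CondMixed P Q → Δ X Y P ≤ Δ X Y' Q) : IsH (fun X _ v => hcol Δ X v) where
  emb := fun X X' _ _ v v' f => hcol_emb Δ h_inv X X' v v' f
  sup := fun X ι _ _ v => hcol_sup Δ h_inv h_add h_scalar h_mono X ι v
  smul := by
    intro X _ c v hc hv
    have := h_leibniz (Fin 1) (Fin 1) X Unit (Matrix.of fun _ _ => c) (Matrix.of fun x _ => v x)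
      (fun _ _ => hc) (fun x _ => hv x)
    rw [h_scalar c hc] at this
    simp only [totalMass, Matrix.of_apply, Finset.univ_unique, Finset.sum_singleton, zero_mul,
      zero_add] at this
    unfold hcol
    rw [← this]
    refine delta_reindex Δ h_inv (Equiv.uniqueProd X (Fin 1)).symm
      (Equiv.uniqueProd Unit (Fin 1)).symm _ _ ?_ ?_
    · intro x y; exact mul_nonneg hc (hv x)
    · intro x y; simp [kron]
  prod := by
    intro X Y _ _ v w hv hw
    have := h_leibniz X Unit Y Unit (Matrix.of fun x _ => v x) (Matrix.of fun x _ => w x)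
      (fun x _ => hv x) (fun x _ => hw x)
    simp only [totalMass, Matrix.of_apply, Finset.univ_unique, Finset.sum_singleton] at this
    unfold hcol
    rw [← this]
    refine delta_reindex Δ h_inv (Equiv.refl _)
      (Equiv.uniqueProd Unit Unit).symm _ _ ?_ ?_
    · intro x y; exact mul_nonneg (hv _) (hw _)
    · intro x y; simp [kron]
  nonneg := by
    classical
    intro X _ v hv
    have h1 := hcol_sup Δ h_inv h_add h_scalar h_mono X X
      (fun i x => if x = i then v i else 0) (fun i x => by
        split_ifs
        · exact hv i
        · exact le_rfl)
    have h2 : ∀ i, hcol Δ X (fun x => if x = i then v i else 0) = 0 := by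
      intro i
      refine Eq.trans (Eq.symm ?_) (h_scalar (v i) (hv i))
      refine h_inv _ _ _ _ _ _ (fun _ _ => hv i) ⟨⟨fun _ => i, fun a b _ => Subsingleton.elim a b⟩,
        ⟨fun _ => (), fun a b _ => Subsingleton.elim a b⟩, ?_, ?_⟩
      · intro x y; simp
        intro h; exact absurd rfl h
      · intro x y h
        refine ⟨⟨0, ?_⟩, ⟨0, rfl⟩⟩
        by_contra hne
        apply h
        simp only [Matrix.of_apply]
        rw [if_neg]
        exact fun h' => hne (Eq.symm h')
    simp only [h2, Finset.sum_const_zero] at h1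
    simpa using h1

end FromDelta

/-! ### Part 2: majorization -/

lemma IsH.add_le {h : ∀ (X : Type) [Fintype X], (X → ℝ) → ℝ} (H : IsH h)
    {X : Type} [Fintype X] (v w : X → ℝ) (hv : ∀ x, 0 ≤ v x) (hw : ∀ x, 0 ≤ w x) :
    h X v + h X w ≤ h X (fun x => v x + w x) := by
  have := H.sup X (Fin 2) ![v, w] (by
    intro i x
    fin_cases i
    · exact hv x
    · exact hw x)
  simpa [Fin.sum_univ_two] using this

lemma IsH.mono {h : ∀ (X : Type) [Fintype X], (X → ℝ) → ℝ} (H : IsH h)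
    {X : Type} [Fintype X] (v w : X → ℝ) (hv : ∀ x, 0 ≤ v x) (hw : ∀ x, v x ≤ w x) :
    h X v ≤ h X w := by
  have h1 := H.add_le v (fun x => w x - v x) hv (fun x => sub_nonneg.2 (hw x))
  have h2 := H.nonneg X (fun x => w x - v x) (fun x => sub_nonneg.2 (hw x))
  have h3 : (fun x => v x + (w x - v x)) = w := by ext x; ring
  rw [h3] at h1
  linarith

lemma abel_aux : ∀ (m : ℕ) (c d : Fin (m + 1) → ℝ), Monotone c →
    (∀ k, 0 ≤ ∑ i, if k ≤ i then d i else 0) → c 0 * ∑ i, d i ≤ ∑ i, c i * d i := by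
  intro m
  induction m with
  | zero => intro c d _ _; simp
  | succ m ih =>
    intro c d hc hd
    have h1 := ih (fun i => c i.succ) (fun i => d i.succ)
      (fun i j hij => hc (Fin.succ_le_succ_iff.2 hij)) (fun k => by
        have := hd k.succ
        rw [Fin.sum_univ_succ] at this
        simpa [Fin.succ_le_succ_iff] using this)
    have h2 := hd (Fin.succ 0)
    rw [Fin.sum_univ_succ] at h2
    simp only [Fin.succ_le_succ_iff, Fin.zero_le, if_true] at h2
    rw [if_neg (by simp), zero_add] at h2
    rw [Fin.sum_univ_succ, Fin.sum_univ_succ (f := fun i => c i * d i), mul_add]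
    have h3 : c 0 ≤ c (Fin.succ 0) := hc (Fin.zero_le _)
    have h4 := mul_le_mul_of_nonneg_right h3 h2
    linarith

lemma tail_aux {m : ℕ} (a b : Fin m → ℝ) (hb0 : ∀ i, 0 ≤ b i) (hb : Monotone b)
    (hs : ∑ i, a i = ∑ i, b i)
    (hmin : ∀ t, 0 ≤ t → ∑ i, min (b i) t ≤ ∑ i, min (a i) t) (k : Fin m) :
    0 ≤ ∑ i, if k ≤ i then (b i - a i) else 0 := by
  have h1 := hmin (b k) (hb0 k)
  have h2 : ∑ i, (b i - min (b i) (b k)) = ∑ i, if k ≤ i then b i - b k else 0 := by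
    refine Finset.sum_congr rfl fun i _ => ?_
    split_ifs with hi
    · rw [min_eq_right (hb hi)]
    · rw [min_eq_left (hb (le_of_not_ge hi))]; ring
  have h3 : ∑ i, (if k ≤ i then a i - b k else 0) ≤ ∑ i, (a i - min (a i) (b k)) := by
    refine Finset.sum_le_sum fun i _ => ?_
    split_ifs with hi
    · linarith [min_le_right (a i) (b k)]
    · linarith [min_le_left (a i) (b k)]
  have h4 : ∑ i, (if k ≤ i then (b i - a i) else 0) =
      ∑ i, (if k ≤ i then b i - b k else 0) - ∑ i, (if k ≤ i then a i - b k else 0) := by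
    rw [← Finset.sum_sub_distrib]
    refine Finset.sum_congr rfl fun i _ => ?_
    split_ifs <;> ring
  rw [Finset.sum_sub_distrib] at h2 h3
  rw [h4]
  linarith

lemma mem_hull_of_majorized {m : ℕ} (a b : Fin (m + 1) → ℝ) (hb0 : ∀ i, 0 ≤ b i)
    (hs : ∑ i, a i = ∑ i, b i)
    (hmin : ∀ t, 0 ≤ t → ∑ i, min (b i) t ≤ ∑ i, min (a i) t) :
    a ∈ convexHull ℝ (Set.range fun σ : Equiv.Perm (Fin (m + 1)) => fun i => b (σ i)) := by
  by_contra hcon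
  obtain ⟨f, u, hf1, hf2⟩ := geometric_hahn_banach_closed_point (convex_convexHull ℝ _)
    (Set.Finite.isClosed_convexHull (𝕜 := ℝ) (Set.finite_range _)) hcon
  let c : Fin (m + 1) → ℝ := fun i => f (Pi.single i 1)
  have hfc : ∀ v : Fin (m + 1) → ℝ, f v = ∑ i, v i * c i := by
    intro v
    have := LinearMap.pi_apply_eq_sum_univ (f : (Fin (m + 1) → ℝ) →ₗ[ℝ] ℝ) v
    simp only [ContinuousLinearMap.coe_coe, smul_eq_mul] at this
    rw [this]
    refine Finset.sum_congr rfl fun i _ => ?_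
    congr 2
    ext j
    simp [Pi.single_apply, eq_comm]
  let σc := Tuple.sort c
  let σb := Tuple.sort b
  have hc : Monotone (fun i => c (σc i)) := Tuple.monotone_sort c
  have hb : Monotone (fun i => b (σb i)) := Tuple.monotone_sort b
  have e1 : ∑ i, a (σc i) = ∑ i, b (σb i) := by
    rw [Equiv.sum_comp σc a, Equiv.sum_comp σb b, hs]
  have h1 := abel_aux m (fun i => c (σc i)) (fun i => b (σb i) - a (σc i)) hc
    (tail_aux (fun i => a (σc i)) (fun i => b (σb i)) (fun i => hb0 _) hb e1 (fun t ht => by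
      rw [Equiv.sum_comp σc (fun i => min (a i) t), Equiv.sum_comp σb (fun i => min (b i) t)]
      exact hmin t ht))
  rw [Finset.sum_sub_distrib, e1, sub_self, mul_zero] at h1
  have h2 := hf1 (fun i => b ((σc.symm.trans σb) i)) (subset_convexHull ℝ _ ⟨_, rfl⟩)
  rw [hfc] at h2 hf2
  rw [← Equiv.sum_comp σc] at h2 hf2
  simp only [Equiv.trans_apply, Equiv.symm_apply_apply] at h2
  have h3 : ∑ i, c (σc i) * (b (σb i) - a (σc i)) =
      ∑ i, b (σb i) * c (σc i) - ∑ i, a (σc i) * c (σc i) := by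
    rw [← Finset.sum_sub_distrib]
    exact Finset.sum_congr rfl fun i _ => by ring
  linarith

lemma IsH.majorize_fin {h : ∀ (X : Type) [Fintype X], (X → ℝ) → ℝ} (H : IsH h)
    {m : ℕ} (a b : Fin (m + 1) → ℝ) (hb0 : ∀ i, 0 ≤ b i)
    (hs : ∑ i, a i = ∑ i, b i)
    (hmin : ∀ t, 0 ≤ t → ∑ i, min (b i) t ≤ ∑ i, min (a i) t) :
    h (Fin (m + 1)) b ≤ h (Fin (m + 1)) a := by
  have hmem := mem_hull_of_majorized a b hb0 hs hmin
  have hsub : convexHull ℝ (Set.range fun σ : Equiv.Perm (Fin (m + 1)) => fun i => b (σ i)) ⊆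
      {v | (∀ i, 0 ≤ v i) ∧ h (Fin (m + 1)) b ≤ h (Fin (m + 1)) v} := by
    apply convexHull_min
    · rintro _ ⟨σ, rfl⟩
      refine ⟨fun i => hb0 _, le_of_eq ?_⟩
      exact H.emb _ _ b (fun i => b (σ i)) σ.symm.toEmbedding hb0 (fun i => by simp)
        (fun i _ => ⟨σ i, by simp⟩)
    · rintro v ⟨hv0, hv⟩ w ⟨hw0, hw⟩ s t hs ht hst
      refine ⟨fun i => add_nonneg (mul_nonneg hs (hv0 i)) (mul_nonneg ht (hw0 i)), ?_⟩
      have h1 := H.add_le (fun i => s * v i) (fun i => t * w i)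
        (fun i => mul_nonneg hs (hv0 i)) (fun i => mul_nonneg ht (hw0 i))
      rw [H.smul _ s v hs hv0, H.smul _ t w ht hw0] at h1
      refine le_trans ?_ h1
      calc h (Fin (m + 1)) b = s * h (Fin (m + 1)) b + t * h (Fin (m + 1)) b := by
            rw [← add_mul, hst, one_mul]
        _ ≤ _ := add_le_add (mul_le_mul_of_nonneg_left hv hs) (mul_le_mul_of_nonneg_left hw ht)
  exact (hsub hmem).2

/-- Schur concavity, for vectors on possibly different index sets. -/
lemma IsH.majorize {h : ∀ (X : Type) [Fintype X], (X → ℝ) → ℝ} (H : IsH h)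
    {X Y : Type} [Fintype X] [Fintype Y] [Nonempty X]
    (a : X → ℝ) (b : Y → ℝ) (ha0 : ∀ i, 0 ≤ a i) (hb0 : ∀ i, 0 ≤ b i)
    (hs : ∑ i, a i = ∑ i, b i)
    (hmin : ∀ t, 0 < t → ∑ i, min (b i) t ≤ ∑ i, min (a i) t) :
    h Y b ≤ h X a := by
  obtain ⟨m, hm⟩ : ∃ m, Fintype.card (X ⊕ Y) = m + 1 :=
    Nat.exists_eq_succ_of_ne_zero Fintype.card_ne_zero
  let e : X ⊕ Y ≃ Fin (m + 1) := Fintype.equivFinOfCardEq hm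
  let a' : Fin (m + 1) → ℝ := fun i => Sum.elim a 0 (e.symm i)
  let b' : Fin (m + 1) → ℝ := fun i => Sum.elim 0 b (e.symm i)
  have h1 : h X a = h _ a' := by
    refine H.emb _ _ a a' (Function.Embedding.inl.trans e.toEmbedding) ha0 ?_ ?_
    · intro x; simp [a']
    · intro i hi
      rcases hx : e.symm i with x | y
      · exact ⟨x, by simp [← hx]⟩
      · simp [a', hx] at hi
  have h2 : h Y b = h _ b' := by
    refine H.emb _ _ b b' (Function.Embedding.inr.trans e.toEmbedding) hb0 ?_ ?_
    · intro x; simp [b']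
    · intro i hi
      rcases hx : e.symm i with x | y
      · simp [b', hx] at hi
      · exact ⟨y, by simp [← hx]⟩
  have sa : ∀ g : ℝ → ℝ, ∑ i, g (a' i) = ∑ x, g (a x) + ∑ _y : Y, g 0 := by
    intro g
    rw [Equiv.sum_comp e.symm (fun z => g (Sum.elim a 0 z)), Fintype.sum_sum_type]
    rfl
  have sb : ∀ g : ℝ → ℝ, ∑ i, g (b' i) = ∑ _x : X, g 0 + ∑ y, g (b y) := by
    intro g
    rw [Equiv.sum_comp e.symm (fun z => g (Sum.elim 0 b z)), Fintype.sum_sum_type]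
    rfl
  rw [h1, h2]
  apply H.majorize_fin
  · intro i
    rcases hx : e.symm i with x | y
    · simp [b', hx]
    · simpa [b', hx] using hb0 y
  · have := sa id
    have := sb id
    simp_all
  · intro t ht
    have h3 := sa (fun z => min z t)
    have h4 := sb (fun z => min z t)
    simp only [min_eq_left ht, Finset.sum_const_zero, add_zero, zero_add] at h3 h4
    rw [h3, h4]
    rcases ht.eq_or_lt with rfl | ht
    · simp [ha0, hb0]
    · exact hmin t ht

/-! ### Part 3: tensor powers and large deviations -/

/-- Tensor power of a vector. -/
def pw {X : Type} (v : X → ℝ) (n : ℕ) (x : Fin n → X) : ℝ := ∏ i, v (x i)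

/-- Strictly positive probability vectors. -/
structure PosProb {X : Type} [Fintype X] (p : X → ℝ) : Prop where
  pos : ∀ x, 0 < p x
  sum : ∑ x, p x = 1

lemma PosProb.nonempty {X : Type} [Fintype X] {p : X → ℝ} (hp : PosProb p) : Nonempty X := by
  by_contra hX
  rw [not_nonempty_iff] at hX
  have := hp.sum
  simp at this

lemma PosProb.le_one {X : Type} [Fintype X] {p : X → ℝ} (hp : PosProb p) (x : X) : p x ≤ 1 := by
  rw [← hp.sum]
  exact Finset.single_le_sum (f := p) (fun i _ => (hp.pos i).le) (Finset.mem_univ x)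

lemma sum_pw {X : Type} [Fintype X] (v : X → ℝ) (n : ℕ) :
    ∑ x, pw v n x = (∑ x, v x) ^ n := by
  rw [Fintype.sum_pow]; rfl

lemma sum_fin_succ {X : Type} [Fintype X] (n : ℕ) (F : (Fin (n + 1) → X) → ℝ) :
    ∑ x, F x = ∑ a, ∑ y, F (Fin.cons a y) := by
  rw [← (Fin.consEquiv (fun _ : Fin (n + 1) => X)).sum_comp, Fintype.sum_prod_type]
  rfl

lemma IsH.unit {h : ∀ (X : Type) [Fintype X], (X → ℝ) → ℝ} (H : IsH h) :
    h Unit (fun _ => 1) = 0 := by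
  have h1 := H.prod Unit Unit (fun _ => 1) (fun _ => 1) (fun _ => zero_le_one)
    (fun _ => zero_le_one)
  have h2 := H.emb Unit (Unit × Unit) (fun _ => 1) (fun _ => 1 * 1)
    (Equiv.uniqueProd Unit Unit).symm.toEmbedding (fun _ => zero_le_one) (by simp)
    (fun x _ => ⟨(), by rfl⟩)
  simp at h1 h2
  linarith

lemma IsH.pw {h : ∀ (X : Type) [Fintype X], (X → ℝ) → ℝ} (H : IsH h)
    {X : Type} [Fintype X] {p : X → ℝ} (hp : PosProb p) (n : ℕ) :
    h (Fin n → X) (pw p n) = n * h X p := by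
  have hpos : ∀ n, ∀ x, 0 ≤ _root_.pw p n x :=
    fun n x => Finset.prod_nonneg fun i _ => (hp.pos _).le
  induction n with
  | zero =>
    rw [← H.emb Unit (Fin 0 → X) (fun _ => 1) (_root_.pw p 0)
      ⟨fun _ => Fin.elim0, fun _ _ _ => rfl⟩
      (fun _ => zero_le_one) (by simp [_root_.pw]) (fun x _ => ⟨(), Subsingleton.elim _ _⟩), H.unit]
    simp
  | succ n ih =>
    have h1 := H.prod X (Fin n → X) p (_root_.pw p n) (fun x => (hp.pos x).le) (hpos n)
    rw [sum_pw, hp.sum, one_pow, ih] at h1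
    rw [← H.emb (X × (Fin n → X)) (Fin (n + 1) → X) (fun z => p z.1 * _root_.pw p n z.2)
      (_root_.pw p (n + 1)) (Fin.consEquiv (fun _ : Fin (n + 1) => X)).toEmbedding
      (fun z => mul_nonneg (hp.pos _).le (hpos n _)) ?_ ?_, h1]
    · push_cast; ring
    · intro z
      simp [_root_.pw, Fin.prod_univ_succ, Fin.consEquiv]
    · intro x _
      exact ⟨(Fin.consEquiv (fun _ : Fin (n + 1) => X)).symm x, by
        simp only [Equiv.coe_toEmbedding, Equiv.apply_symm_apply]⟩

lemma moment1 {X : Type} [Fintype X] (w g : X → ℝ) (hw : ∑ x, w x = 1)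
    (hg : ∑ x, w x * g x = 0) (n : ℕ) : ∑ x, pw w n x * ∑ i, g (x i) = 0 := by
  induction n with
  | zero => simp
  | succ n ih =>
    rw [sum_fin_succ]
    have : ∀ a, ∀ y : Fin n → X, pw w (n + 1) (Fin.cons a y) *
        ∑ i, g ((Fin.cons a y : Fin (n + 1) → X) i) =
        (w a * g a) * pw w n y + w a * (pw w n y * ∑ i, g (y i)) := by
      intro a y
      simp only [pw, Fin.prod_univ_succ, Fin.sum_univ_succ, Fin.cons_zero, Fin.cons_succ]
      ring
    simp only [this, Finset.sum_add_distrib, ← Finset.mul_sum, ih, sum_pw, hw, one_pow]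
    simp [hg]

lemma moment2 {X : Type} [Fintype X] (w g : X → ℝ) (hw : ∑ x, w x = 1)
    (hg : ∑ x, w x * g x = 0) (n : ℕ) :
    ∑ x, pw w n x * (∑ i, g (x i)) ^ 2 = n * ∑ x, w x * g x ^ 2 := by
  induction n with
  | zero => simp
  | succ n ih =>
    rw [sum_fin_succ]
    have : ∀ a, ∀ y : Fin n → X, pw w (n + 1) (Fin.cons a y) *
        (∑ i, g ((Fin.cons a y : Fin (n + 1) → X) i)) ^ 2 =
        (w a * g a ^ 2) * pw w n y + (2 * (w a * g a)) * (pw w n y * ∑ i, g (y i)) +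
          w a * (pw w n y * (∑ i, g (y i)) ^ 2) := by
      intro a y
      simp only [pw, Fin.prod_univ_succ, Fin.sum_univ_succ, Fin.cons_zero, Fin.cons_succ]
      ring
    simp only [this, Finset.sum_add_distrib, ← Finset.mul_sum, ih, sum_pw, hw, one_pow,
      moment1 w g hw hg n]
    simp only [mul_one, mul_zero, Finset.sum_const_zero, add_zero, ← Finset.sum_mul, hw]
    push_cast; ring

lemma cheb {X : Type} [Fintype X] (w g : X → ℝ) (μ M δ : ℝ) (n : ℕ) (hw0 : ∀ x, 0 ≤ w x)
    (hw : ∑ x, w x = 1) (hμ : ∑ x, w x * g x = μ) (hM : ∀ x, |g x - μ| ≤ M) (hδ : 0 < δ)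
    (hn : 0 < n) :
    1 - M ^ 2 / (n * δ ^ 2) ≤
      ∑ x : Fin n → X, if |∑ i, g (x i) - n * μ| ≤ n * δ then pw w n x else 0 := by
  have hn' : (0 : ℝ) < n := by exact_mod_cast hn
  have h0 : ∀ x : Fin n → X, 0 ≤ pw w n x := fun x => Finset.prod_nonneg fun i _ => hw0 _
  have h1 := moment2 w (fun x => g x - μ) hw (by
    simp only [mul_sub, Finset.sum_sub_distrib, ← Finset.sum_mul, hw, hμ]; ring) n
  have h2 : ∑ x, w x * (g x - μ) ^ 2 ≤ M ^ 2 := by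
    calc ∑ x, w x * (g x - μ) ^ 2 ≤ ∑ x, w x * M ^ 2 := by
          refine Finset.sum_le_sum fun x _ => mul_le_mul_of_nonneg_left ?_ (hw0 x)
          rw [← sq_abs]
          exact pow_le_pow_left₀ (abs_nonneg _) (hM x) 2
      _ = M ^ 2 := by rw [← Finset.sum_mul, hw, one_mul]
  have h3 : ∑ x : Fin n → X, pw w n x = 1 := by rw [sum_pw, hw, one_pow]
  have h4 : ∀ x : Fin n → X, pw w n x - (if |∑ i, g (x i) - n * μ| ≤ n * δ then pw w n x else 0)
      ≤ pw w n x * (∑ i, (g (x i) - μ)) ^ 2 / (n * δ) ^ 2 := by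
    intro x
    have e : ∑ i, (g (x i) - μ) = ∑ i, g (x i) - n * μ := by
      simp [Finset.sum_sub_distrib]
    rw [e]
    split_ifs with hx
    · rw [sub_self]
      exact div_nonneg (mul_nonneg (h0 x) (sq_nonneg _)) (sq_nonneg _)
    · rw [sub_zero, le_div_iff₀ (by positivity)]
      refine mul_le_mul_of_nonneg_left ?_ (h0 x)
      rw [← sq_abs (∑ i, g (x i) - n * μ)]
      exact pow_le_pow_left₀ (by positivity) (not_le.1 hx).le 2
  have h5 := Finset.sum_le_sum (fun x (_ : x ∈ Finset.univ) => h4 x)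
  rw [Finset.sum_sub_distrib, h3, ← Finset.sum_div, h1] at h5
  have h6 : (n : ℝ) * (∑ x, w x * (g x - μ) ^ 2) / (n * δ) ^ 2 ≤ M ^ 2 / (n * δ ^ 2) := by
    rw [div_le_div_iff₀ (by positivity) (by positivity)]
    nlinarith [mul_le_mul_of_nonneg_left h2 (by positivity : (0 : ℝ) ≤ n ^ 2 * δ ^ 2)]
  linarith

/-- The partition function. -/
def Zf {X : Type} [Fintype X] (p : X → ℝ) (α : ℝ) : ℝ := ∑ x, p x ^ α

/-- The natural-log Rényi entropy on a full-support distribution. -/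
def Hn {X : Type} [Fintype X] (p : X → ℝ) (α : ℝ) : ℝ :=
  -dslope (fun a => Real.log (Zf p a)) 1 α

/-- Mean of `-log p` under the tilted distribution. -/
def muf {X : Type} [Fintype X] (p : X → ℝ) (α : ℝ) : ℝ :=
  ∑ x, p x ^ α / Zf p α * (-Real.log (p x))

section
variable {X : Type} [Fintype X] {p : X → ℝ}

lemma PosProb.Zpos (hp : PosProb p) (α : ℝ) : 0 < Zf p α := by
  have := hp.nonempty
  exact Finset.sum_pos (fun x _ => Real.rpow_pos_of_pos (hp.pos x) α) Finset.univ_nonempty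

lemma PosProb.Z_one (hp : PosProb p) : Zf p 1 = 1 := by
  simp [Zf, hp.sum]

lemma PosProb.Z_hasDeriv (hp : PosProb p) (α : ℝ) :
    HasDerivAt (Zf p) (∑ x, p x ^ α * Real.log (p x)) α := by
  unfold Zf
  refine HasDerivAt.fun_sum fun x _ => ?_
  have := (hasDerivAt_id α).const_rpow (hp.pos x)
  simpa [mul_comm] using this

lemma PosProb.logZ_diff (hp : PosProb p) (α : ℝ) :
    HasDerivAt (fun a => Real.log (Zf p a)) ((∑ x, p x ^ α * Real.log (p x)) / Zf p α) α :=
  (hp.Z_hasDeriv α).log (hp.Zpos α).ne'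

lemma PosProb.Z_cont (hp : PosProb p) : Continuous (Zf p) :=
  continuous_iff_continuousAt.2 fun α => (hp.Z_hasDeriv α).continuousAt

lemma PosProb.Hn_mul (hp : PosProb p) (α : ℝ) : (1 - α) * Hn p α = Real.log (Zf p α) := by
  have := sub_smul_dslope (fun a => Real.log (Zf p a)) 1 α
  simp only [hp.Z_one, Real.log_one, sub_zero, smul_eq_mul] at this
  rw [← this, Hn]; ring

lemma PosProb.Hn_cont (hp : PosProb p) : Continuous (Hn p) := by
  refine Continuous.neg (continuous_iff_continuousAt.2 fun α => ?_)
  by_cases h : α = 1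
  · rw [h, continuousAt_dslope_same]
    exact (hp.logZ_diff 1).differentiableAt
  · rw [continuousAt_dslope_of_ne h]
    exact (hp.logZ_diff α).continuousAt

lemma PosProb.Hn_one (hp : PosProb p) : Hn p 1 = -∑ x, p x * Real.log (p x) := by
  rw [Hn, dslope_same, (hp.logZ_diff 1).deriv, hp.Z_one]
  simp

lemma PosProb.muf_one (hp : PosProb p) : muf p 1 = Hn p 1 := by
  rw [hp.Hn_one, muf, hp.Z_one, ← Finset.sum_neg_distrib]
  exact Finset.sum_congr rfl fun x _ => by simp

lemma PosProb.muf_cont (hp : PosProb p) : Continuous (muf p) := by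
  unfold muf
  refine continuous_finsetSum _ fun x _ => ?_
  refine Continuous.mul (Continuous.div ?_ hp.Z_cont fun α => (hp.Zpos α).ne') continuous_const
  exact Continuous.rpow continuous_const continuous_id fun _ => Or.inl (hp.pos x).ne'

lemma PosProb.logZ_nonneg (hp : PosProb p) {α : ℝ} (h1 : α ≤ 1) :
    0 ≤ Real.log (Zf p α) := by
  apply Real.log_nonneg
  rw [← hp.sum]
  refine Finset.sum_le_sum fun x _ => ?_
  calc p x = p x ^ (1 : ℝ) := (Real.rpow_one _).symm
    _ ≤ p x ^ α := Real.rpow_le_rpow_of_exponent_ge (hp.pos x) (hp.le_one x) h1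

lemma PosProb.tilt_sum (hp : PosProb p) (α : ℝ) : ∑ x, p x ^ α / Zf p α = 1 := by
  rw [← Finset.sum_div]
  exact div_self (hp.Zpos α).ne'

lemma PosProb.muf_mem (hp : PosProb p) {M : ℝ} (hM : ∀ x, -Real.log (p x) ≤ M) (α : ℝ) :
    0 ≤ muf p α ∧ muf p α ≤ M := by
  have hw : ∀ x, 0 ≤ p x ^ α / Zf p α := fun x =>
    div_nonneg (Real.rpow_nonneg (hp.pos x).le _) (hp.Zpos α).le
  constructor
  · exact Finset.sum_nonneg fun x _ => mul_nonneg (hw x)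
      (neg_nonneg.2 (Real.log_nonpos (hp.pos x).le (hp.le_one x)))
  · calc muf p α ≤ ∑ x, p x ^ α / Zf p α * M :=
        Finset.sum_le_sum fun x _ => mul_le_mul_of_nonneg_left (hM x) (hw x)
      _ = M := by rw [← Finset.sum_mul, hp.tilt_sum, one_mul]

lemma PosProb.exists_tilt (hp : PosProb p) (s : ℝ) :
    ∃ α, 0 ≤ α ∧ α ≤ 1 ∧ (α = 0 ∨ s ≤ muf p α) ∧ (α = 1 ∨ muf p α ≤ s) := by
  by_cases h1 : s ≤ muf p 1
  · exact ⟨1, zero_le_one, le_rfl, Or.inr h1, Or.inl rfl⟩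
  by_cases h0 : muf p 0 ≤ s
  · exact ⟨0, le_rfl, zero_le_one, Or.inl rfl, Or.inr h0⟩
  obtain ⟨α, hα, h⟩ := intermediate_value_Icc' (zero_le_one (α := ℝ)) hp.muf_cont.continuousOn
    (⟨(not_le.1 h1).le, (not_le.1 h0).le⟩ : s ∈ Set.Icc (muf p 1) (muf p 0))
  exact ⟨α, hα.1, hα.2, Or.inr h.ge, Or.inr h.le⟩

lemma PosProb.pw_eq (hp : PosProb p) (n : ℕ) (x : Fin n → X) :
    pw p n x = Real.exp (-∑ i, -Real.log (p (x i))) := by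
  rw [Finset.sum_neg_distrib, neg_neg, Real.exp_sum]
  exact Finset.prod_congr rfl fun i _ => (Real.exp_log (hp.pos _)).symm

lemma PosProb.pw_tilt (hp : PosProb p) (α : ℝ) (n : ℕ) (x : Fin n → X) :
    pw (fun x => p x ^ α / Zf p α) n x * Zf p α ^ n =
      Real.exp (-(α * ∑ i, -Real.log (p (x i)))) := by
  unfold pw
  rw [Finset.prod_div_distrib]
  simp only [Finset.prod_const, Finset.card_univ, Fintype.card_fin]
  rw [div_mul_cancel₀ _ (pow_ne_zero _ (hp.Zpos α).ne'), Finset.sum_neg_distrib, mul_neg, neg_neg,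
    Finset.mul_sum, Real.exp_sum]
  refine Finset.prod_congr rfl fun i _ => ?_
  rw [Real.rpow_def_of_pos (hp.pos _), mul_comm]

/-- Cramér lower bound. -/
lemma PosProb.lower (hp : PosProb p) {M : ℝ} (hM : ∀ x, -Real.log (p x) ≤ M) (s δ α : ℝ) (n : ℕ)
    (hn : 0 < n) (hδ : 0 < δ) (h0 : 0 ≤ α) (h1 : α ≤ 1) (ha : α = 0 ∨ s ≤ muf p α)
    (hb : α = 1 ∨ muf p α ≤ s) :
    (1 - M ^ 2 / (n * δ ^ 2)) * Real.exp (-(n * δ) + n * (Real.log (Zf p α) - (1 - α) * s)) ≤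
      ∑ x, min (pw p n x) (Real.exp (-(n * s))) := by
  have hn' : (0 : ℝ) < n := by exact_mod_cast hn
  have hg : ∀ x, 0 ≤ -Real.log (p x) := fun x =>
    neg_nonneg.2 (Real.log_nonpos (hp.pos x).le (hp.le_one x))
  obtain ⟨m0, m1⟩ := hp.muf_mem hM α
  have hc := cheb (fun x => p x ^ α / Zf p α) (fun x => -Real.log (p x)) (muf p α) M δ n
    (fun x => div_nonneg (Real.rpow_nonneg (hp.pos x).le _) (hp.Zpos α).le) (hp.tilt_sum α) rfl
    (fun x => by rw [abs_le]; constructor <;> linarith [hg x, hM x]) hδ hn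
  refine (mul_le_mul_of_nonneg_right hc (Real.exp_pos _).le).trans ?_
  rw [Finset.sum_mul]
  refine Finset.sum_le_sum fun x _ => ?_
  split_ifs with hx
  · have e1 : Real.exp (-(n * δ) + n * (Real.log (Zf p α) - (1 - α) * s)) =
        Zf p α ^ n * Real.exp (-(n * δ) - n * (1 - α) * s) := by
      have : Zf p α ^ n = Real.exp (n * Real.log (Zf p α)) := by
        rw [Real.exp_nat_mul, Real.exp_log (hp.Zpos α)]
      rw [this, ← Real.exp_add]
      congr 1; ring
    rw [e1, ← mul_assoc, hp.pw_tilt, ← Real.exp_add, hp.pw_eq]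
    set A := ∑ i, -Real.log (p (x i)) with hA
    rw [abs_le] at hx
    have hnδ : 0 < n * δ := by positivity
    refine le_min (Real.exp_le_exp.2 ?_) (Real.exp_le_exp.2 ?_)
    · have : (1 - α) * (A - n * s) ≤ n * δ := by
        rcases hb with hb | hb
        · rw [hb]; linarith
        · have : A - n * s ≤ n * δ := by
            have := mul_le_mul_of_nonneg_left hb hn'.le
            linarith [hx.2]
          nlinarith
      linarith
    · have : α * (n * s - A) ≤ n * δ := by
        rcases ha with ha | ha
        · rw [ha]; linarith
        · have : n * s - A ≤ n * δ := by
            have := mul_le_mul_of_nonneg_left ha hn'.le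
            linarith [hx.1]
          nlinarith
      linarith
  · rw [zero_mul]
    exact le_min (Finset.prod_nonneg fun i _ => (hp.pos _).le) (Real.exp_pos _).le

/-- Chernoff upper bound. -/
lemma PosProb.upper (hp : PosProb p) (s α : ℝ) (n : ℕ) (h0 : 0 ≤ α) (h1 : α ≤ 1) :
    ∑ x, min (pw p n x) (Real.exp (-(n * s))) ≤
      Real.exp (n * (Real.log (Zf p α) - (1 - α) * s)) := by
  have e1 : Real.exp (n * (Real.log (Zf p α) - (1 - α) * s)) =
      Zf p α ^ n * Real.exp (-(n * (1 - α) * s)) := by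
    have : Zf p α ^ n = Real.exp (n * Real.log (Zf p α)) := by
      rw [Real.exp_nat_mul, Real.exp_log (hp.Zpos α)]
    rw [this, ← Real.exp_add]
    congr 1; ring
  have e2 : Zf p α ^ n = ∑ x, pw (fun x => p x ^ α / Zf p α) n x * Zf p α ^ n := by
    rw [← Finset.sum_mul, sum_pw, hp.tilt_sum, one_pow, one_mul]
  rw [e1, e2, Finset.sum_mul]
  refine Finset.sum_le_sum fun x _ => ?_
  rw [hp.pw_tilt, ← Real.exp_add, hp.pw_eq]
  set A := ∑ i, -Real.log (p (x i)) with hA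
  rcases le_total A (n * s) with h | h
  · refine (min_le_right _ _).trans (Real.exp_le_exp.2 ?_)
    nlinarith
  · refine (min_le_left _ _).trans (Real.exp_le_exp.2 ?_)
    nlinarith [mul_nonneg (sub_nonneg.2 h1) (sub_nonneg.2 h)]

/-- The truncated mass is close to one. -/
lemma PosProb.mass (hp : PosProb p) {M : ℝ} (hM : ∀ x, -Real.log (p x) ≤ M) (s : ℝ) (n : ℕ)
    (hn : 0 < n) (hs : s < Hn p 1) :
    1 - M ^ 2 / (n * (Hn p 1 - s) ^ 2) ≤ ∑ x, min (pw p n x) (Real.exp (-(n * s))) := by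
  have hg : ∀ x, 0 ≤ -Real.log (p x) := fun x =>
    neg_nonneg.2 (Real.log_nonpos (hp.pos x).le (hp.le_one x))
  obtain ⟨m0, m1⟩ := hp.muf_mem hM 1
  have e : ∑ x, p x * -Real.log (p x) = muf p 1 := by
    rw [muf, hp.Z_one]
    exact Finset.sum_congr rfl fun x _ => by simp
  have hc := cheb p (fun x => -Real.log (p x)) (muf p 1) M (Hn p 1 - s) n
    (fun x => (hp.pos x).le) hp.sum e
    (fun x => by rw [abs_le]; constructor <;> linarith [hg x, hM x]) (by linarith) hn
  refine hc.trans (Finset.sum_le_sum fun x _ => ?_)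
  split_ifs with hx
  · refine le_min le_rfl ?_
    rw [hp.pw_eq]
    apply Real.exp_le_exp.2
    rw [abs_le, hp.muf_one] at hx
    linarith [hx.1]
  · exact le_min (Finset.prod_nonneg fun i _ => (hp.pos _).le) (Real.exp_pos _).le

end

/-! ### Part 4: the core comparison -/

lemma tail_compare {X Y : Type} [Fintype X] [Fintype Y] {p : X → ℝ} {q : Y → ℝ}
    (hp : PosProb p) (hq : PosProb q)
    (hgap : ∀ α, 0 ≤ α → α ≤ 1 → Hn q α < Hn p α) {M : ℝ} (hM0 : 0 < M)
    (hM : ∀ x, -Real.log (p x) ≤ M) (s0 : ℝ) (hs0 : Hn q 1 < s0) :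
    ∃ N : ℕ, ∀ n : ℕ, N ≤ n → ∀ s, s0 ≤ s →
      ∑ y, min (pw q n y) (Real.exp (-(n * s))) ≤ ∑ x, min (pw p n x) (Real.exp (-(n * s))) := by
  obtain ⟨ε, hε, hgap'⟩ : ∃ ε, 0 < ε ∧ ∀ α, 0 ≤ α → α ≤ 1 → ε ≤ Hn p α - Hn q α := by
    obtain ⟨a, ha, hmin⟩ := (isCompact_Icc (a := (0 : ℝ)) (b := 1)).exists_isMinOn
      ⟨0, by simp⟩ (f := fun α => Hn p α - Hn q α) (hp.Hn_cont.sub hq.Hn_cont).continuousOn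
    exact ⟨Hn p a - Hn q a, sub_pos.2 (hgap a ha.1 ha.2), fun α h0 h1 => hmin ⟨h0, h1⟩⟩
  obtain ⟨α1, h10, h11, h12⟩ : ∃ α1, 0 ≤ α1 ∧ α1 < 1 ∧ Hn q α1 < s0 := by
    have h1 : ∀ᶠ α in nhdsWithin (1 : ℝ) (Set.Iio 1), Hn q α < s0 :=
      (hq.Hn_cont.continuousAt.eventually_lt continuousAt_const hs0).filter_mono
        nhdsWithin_le_nhds
    have h2 : ∀ᶠ α in nhdsWithin (1 : ℝ) (Set.Iio 1), α ∈ Set.Ioo (0 : ℝ) 1 :=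
      Ioo_mem_nhdsLT zero_lt_one
    obtain ⟨α, ha, hb⟩ := (h1.and h2).exists
    exact ⟨α, hb.1.le, hb.2, ha⟩
  set η := (1 - α1) * (s0 - Hn q α1) with hη
  have hη0 : 0 < η := mul_pos (by linarith) (by linarith)
  set κ := min 1 (η / (2 * M)) with hκ
  have hκ0 : 0 < κ := lt_min one_pos (by positivity)
  have hκ1 : κ ≤ 1 := min_le_left _ _
  have hκM : κ * M ≤ η / 2 := by
    calc κ * M ≤ η / (2 * M) * M := mul_le_mul_of_nonneg_right (min_le_right _ _) hM0.le
      _ = η / 2 := by field_simp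
  set δ := min (κ * ε) (η / 2) / 2 with hδd
  have hδ : 0 < δ := half_pos (lt_min (by positivity) (by positivity))
  have hδ1 : 2 * δ ≤ κ * ε := by
    have := min_le_left (κ * ε) (η / 2); linarith
  have hδ2 : 2 * δ ≤ η / 2 := by
    have := min_le_right (κ * ε) (η / 2); linarith
  obtain ⟨N, hN⟩ := exists_nat_gt (max (2 * M ^ 2 / δ ^ 2) (1 / δ))
  refine ⟨N, fun n hn s hs => ?_⟩
  have hnN : max (2 * M ^ 2 / δ ^ 2) (1 / δ) < n := hN.trans_le (by exact_mod_cast hn)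
  have hn0 : (0 : ℝ) < n := lt_of_le_of_lt ((by positivity : (0 : ℝ) ≤ 1 / δ).trans
    (le_max_right _ _)) hnN
  have hn0' : 0 < n := by exact_mod_cast hn0
  have hnδ : 1 ≤ n * δ := by
    have := (le_max_right _ _).trans hnN.le
    rwa [div_le_iff₀ hδ] at this
  have hcheb : M ^ 2 / (n * δ ^ 2) ≤ 1 / 2 := by
    have := (le_max_left _ _).trans hnN.le
    rw [div_le_iff₀ (by positivity)] at this
    rw [div_le_iff₀ (by positivity)]
    linarith
  obtain ⟨α, h0, h1, ha, hb⟩ := hp.exists_tilt s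
  have hlow := hp.lower hM s δ α n hn0' hδ h0 h1 ha hb
  have hexp : Real.exp (-(n * δ)) ≤ 1 / 2 := by
    have h2 : (2 : ℝ) ≤ Real.exp (n * δ) := by
      have := Real.add_one_le_exp (n * δ); linarith
    rw [Real.exp_neg, ← one_div]
    exact one_div_le_one_div_of_le two_pos h2
  have hlow2 : Real.exp (n * (-(2 * δ) + (Real.log (Zf p α) - (1 - α) * s))) ≤
      ∑ x, min (pw p n x) (Real.exp (-(n * s))) := by
    refine le_trans ?_ hlow
    have e : (n : ℝ) * (-(2 * δ) + (Real.log (Zf p α) - (1 - α) * s)) =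
      -(n * δ) + (-(n * δ) + n * (Real.log (Zf p α) - (1 - α) * s)) := by ring
    rw [e, Real.exp_add (-(n * δ))]
    exact mul_le_mul_of_nonneg_right (by linarith) (Real.exp_pos _).le
  refine le_trans ?_ hlow2
  by_cases hc : κ ≤ 1 - α
  · refine (hq.upper s α n h0 h1).trans (Real.exp_le_exp.2 ?_)
    refine mul_le_mul_of_nonneg_left ?_ hn0.le
    rw [← hp.Hn_mul, ← hq.Hn_mul]
    have := hgap' α h0 h1
    have : κ * ε ≤ (1 - α) * (Hn p α - Hn q α) := mul_le_mul hc this hε.le (by linarith)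
    linarith
  · push Not at hc
    refine (hq.upper s α1 n h10 h11.le).trans (Real.exp_le_exp.2 ?_)
    refine mul_le_mul_of_nonneg_left ?_ hn0.le
    have hsM : s ≤ M := by
      rcases ha with ha | ha
      · subst ha; linarith
      · exact ha.trans (hp.muf_mem hM α).2
    have h3 : (1 - α) * s ≤ κ * M :=
      (mul_le_mul_of_nonneg_left hsM (by linarith)).trans
        (mul_le_mul_of_nonneg_right hc.le hM0.le)
    have h4 := hp.logZ_nonneg h1
    have h5 : (1 - α1) * s0 ≤ (1 - α1) * s := mul_le_mul_of_nonneg_left hs (by linarith)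
    rw [← hq.Hn_mul α1]
    have h6 : η = (1 - α1) * s0 - (1 - α1) * Hn q α1 := by rw [hη]; ring
    linarith

lemma core_compare {h : ∀ (X : Type) [Fintype X], (X → ℝ) → ℝ} (H : IsH h)
    {X Y : Type} [Fintype X] [Fintype Y] {p : X → ℝ} {q : Y → ℝ}
    (hp : PosProb p) (hq : PosProb q)
    (hgap : ∀ α, 0 ≤ α → α ≤ 1 → Hn q α < Hn p α) : h Y q ≤ h X p := by
  have hXn := hp.nonempty
  obtain ⟨M, hM0, hM⟩ : ∃ M, 0 < M ∧ ∀ x, -Real.log (p x) ≤ M := by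
    have hg : ∀ x, 0 ≤ -Real.log (p x) := fun x =>
      neg_nonneg.2 (Real.log_nonpos (hp.pos x).le (hp.le_one x))
    refine ⟨1 + ∑ x, -Real.log (p x), ?_, fun x => ?_⟩
    · have := Finset.sum_nonneg fun x (_ : x ∈ Finset.univ) => hg x
      linarith
    · have := Finset.single_le_sum (f := fun x => -Real.log (p x)) (fun x _ => hg x)
        (Finset.mem_univ x)
      beta_reduce at this
      linarith
  set s0 := (Hn q 1 + Hn p 1) / 2 with hs0
  have hg1 := hgap 1 zero_le_one le_rfl
  obtain ⟨N, hN⟩ := tail_compare hp hq hgap hM0 hM s0 (by linarith)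
  set d := Hn p 1 - s0 with hd
  have hd0 : 0 < d := by linarith
  have key : ∀ n : ℕ, N ≤ n → 0 < n → (1 - M ^ 2 / (n * d ^ 2)) * h Y q ≤ h X p := by
    intro n hn hn0
    have hn0' : (0 : ℝ) < n := by exact_mod_cast hn0
    set t0 := Real.exp (-(n * s0)) with ht0
    have ht00 : 0 < t0 := Real.exp_pos _
    have hpp : ∀ x, 0 ≤ pw p n x := fun x => Finset.prod_nonneg fun i _ => (hp.pos _).le
    have hqq : ∀ x, 0 ≤ pw q n x := fun x => Finset.prod_nonneg fun i _ => (hq.pos _).le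
    set v : (Fin n → X) → ℝ := fun x => min (pw p n x) t0 with hv
    set V := ∑ x, v x with hV
    have hv0 : ∀ x, 0 ≤ v x := fun x => le_min (hpp x) ht00.le
    have hV0 : 0 ≤ V := Finset.sum_nonneg fun x _ => hv0 x
    have hV1 : V ≤ 1 := by
      calc V ≤ ∑ x, pw p n x := Finset.sum_le_sum fun x _ => min_le_left _ _
        _ = 1 := by rw [sum_pw, hp.sum, one_pow]
    have hm := H.majorize v (fun y => V * pw q n y) hv0 (fun y => mul_nonneg hV0 (hqq y))
      (by rw [← Finset.mul_sum, sum_pw, hq.sum, one_pow, mul_one]) (by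
        intro t ht
        rcases le_total t0 t with h1 | h1
        · calc ∑ y, min (V * pw q n y) t ≤ ∑ y, V * pw q n y :=
              Finset.sum_le_sum fun y _ => min_le_left _ _
            _ = V := by rw [← Finset.mul_sum, sum_pw, hq.sum, one_pow, mul_one]
            _ = ∑ x, min (v x) t := Finset.sum_congr rfl fun x _ =>
              (min_eq_left ((min_le_right _ _).trans h1)).symm
        · have e : Real.exp (-(n * (-Real.log t / n))) = t := by
            rw [mul_div_cancel₀ _ hn0'.ne', neg_neg, Real.exp_log ht]
          have hs : s0 ≤ -Real.log t / n := by
            have := Real.log_le_log ht h1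
            rw [ht0, Real.log_exp] at this
            rw [le_div_iff₀ hn0']
            linarith
          have h2 := hN n hn _ hs
          rw [e] at h2
          calc ∑ y, min (V * pw q n y) t ≤ ∑ y, min (pw q n y) t :=
              Finset.sum_le_sum fun y _ => min_le_min_right _
                (mul_le_of_le_one_left (hqq y) hV1)
            _ ≤ _ := h2
            _ = ∑ x, min (v x) t := Finset.sum_congr rfl fun x _ => by
              rw [hv]; simp only [min_assoc, min_eq_right h1])
    have h2 := H.mono v (pw p n) hv0 (fun x => min_le_left _ _)
    have h3 := H.smul (Fin n → Y) V (pw q n) hV0 hqq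
    have h4 := hp.mass hM s0 n hn0 (by linarith)
    rw [H.pw hp] at h2
    rw [H.pw hq] at h3
    have h5 : n * (V * h Y q) ≤ n * h X p := by
      calc n * (V * h Y q) = V * (n * h Y q) := by ring
        _ ≤ n * h X p := by rw [← h3]; exact hm.trans h2
    have h6 := le_of_mul_le_mul_left h5 hn0'
    exact (mul_le_mul_of_nonneg_right h4 (H.nonneg Y q fun y => (hq.pos y).le)).trans h6
  have hlim : Filter.Tendsto (fun n : ℕ => (1 - M ^ 2 / (n * d ^ 2)) * h Y q) Filter.atTop
      (nhds ((1 - 0) * h Y q)) := by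
    refine Filter.Tendsto.mul_const _ (tendsto_const_nhds.sub ?_)
    exact Filter.Tendsto.const_div_atTop
      (tendsto_natCast_atTop_atTop.atTop_mul_const (by positivity)) _
  rw [sub_zero, one_mul] at hlim
  refine le_of_tendsto hlim ?_
  filter_upwards [Filter.eventually_ge_atTop N, Filter.eventually_gt_atTop 0] with n h1 h2
  exact key n h1 h2

/-! ### Part 5: positive extension and representation by a measure -/

section Functional
variable {K : Type} [TopologicalSpace K] [CompactSpace K]

lemma exists_functional (R : AddSubgroup (C(K, ℝ) × ℝ)) (c : ℝ)
    (hone : ((1 : C(K, ℝ)), c) ∈ R)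
    (hpos : ∀ x ∈ R, (∀ k, 0 < x.1 k) → 0 ≤ x.2) :
    ∃ L : C(K, ℝ) →ₗ[ℝ] ℝ, (∀ f : C(K, ℝ), (∀ k, 0 ≤ f k) → 0 ≤ L f) ∧
      ∀ x ∈ R, L x.1 = x.2 := by
  let S : Set (C(K, ℝ) × ℝ) := {x | ∃ m : ℕ, 0 < m ∧ m • x ∈ R}
  have hRS : ∀ x ∈ R, x ∈ S := fun x hx => ⟨1, one_pos, by simpa using hx⟩
  have hadd : ∀ x ∈ S, ∀ y ∈ S, x + y ∈ S := by
    rintro x ⟨m, hm, hx⟩ y ⟨n, hn, hy⟩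
    refine ⟨m * n, Nat.mul_pos hm hn, ?_⟩
    have e : (m * n) • (x + y) = n • (m • x) + m • (n • y) := by
      rw [smul_add, ← mul_smul, ← mul_smul, mul_comm n m]
    rw [e]
    exact R.add_mem (R.nsmul_mem hx n) (R.nsmul_mem hy m)
  have hrat : ∀ (a : ℚ), ∀ x ∈ S, (a : ℝ) • x ∈ S := by
    rintro a x ⟨m, hm, hx⟩
    refine ⟨m * a.den, Nat.mul_pos hm a.den_pos, ?_⟩
    have e : (m * a.den) • ((a : ℝ) • x) = a.num • (m • x) := by
      rw [← Nat.cast_smul_eq_nsmul ℝ, ← Nat.cast_smul_eq_nsmul ℝ, ← Int.cast_smul_eq_zsmul ℝ,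
        ← mul_smul, ← mul_smul]
      congr 1
      have : (a.den : ℝ) * (a : ℝ) = a.num := by
        have := Rat.den_mul_eq_num a
        exact_mod_cast this
      push_cast
      rw [mul_assoc, this, mul_comm]
    rw [e]
    exact R.zsmul_mem hx _
  have hSpos : ∀ x ∈ S, (∀ k, 0 < x.1 k) → 0 ≤ x.2 := by
    rintro x ⟨m, hm, hx⟩ hk
    have hm' : (0 : ℝ) < m := by exact_mod_cast hm
    have := hpos _ hx (fun k => by
      simp only [Prod.smul_fst, ContinuousMap.smul_apply, nsmul_eq_mul]
      exact mul_pos hm' (hk k))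
    simp only [Prod.smul_snd, nsmul_eq_mul] at this
    exact nonneg_of_mul_nonneg_right this hm'
  have hclosR : ∀ x ∈ closure S, ∀ a : ℝ, a • x ∈ closure S := by
    intro x hx a
    refine Rat.denseRange_cast.induction_on (p := fun a : ℝ => a • x ∈ closure S) a ?_ ?_
    · exact isClosed_closure.preimage (continuous_id.smul continuous_const)
    · intro b
      exact map_mem_closure (f := fun y => (b : ℝ) • y) (continuous_const_smul _) hx
        (fun y hy => hrat b y hy)
  let W : Submodule ℝ (C(K, ℝ) × ℝ) :=
    { carrier := closure S
      add_mem' := fun {x y} hx hy => map_mem_closure₂ continuous_add hx hy hadd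
      zero_mem' := subset_closure (hRS _ R.zero_mem)
      smul_mem' := fun a x hx => hclosR x hx a }
  have hU : IsOpen {x : C(K, ℝ) × ℝ | ∀ k, 0 < x.1 k} := by
    have h1 : IsOpen {f : C(K, ℝ) | Set.MapsTo f Set.univ (Set.Ioi 0)} :=
      ContinuousMap.isOpen_setOfPred_mapsTo isCompact_univ isOpen_Ioi
    have h2 := h1.preimage (continuous_fst (X := C(K, ℝ)) (Y := ℝ))
    convert h2 using 1
    ext x
    simp [Set.MapsTo]
  have hWpos' : ∀ x ∈ W, (∀ k, 0 < x.1 k) → 0 ≤ x.2 := by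
    intro x hx hk
    have h1 : x ∈ closure ({x : C(K, ℝ) × ℝ | ∀ k, 0 < x.1 k} ∩ S) :=
      hU.inter_closure ⟨hk, hx⟩
    have h2 : IsClosed {x : C(K, ℝ) × ℝ | 0 ≤ x.2} := isClosed_le continuous_const continuous_snd
    exact closure_minimal (fun y hy => hSpos y hy.2 hy.1) h2 h1
  have hWone : ((1 : C(K, ℝ)), c) ∈ W := subset_closure (hRS _ hone)
  have hWpos : ∀ x ∈ W, (∀ k, 0 ≤ x.1 k) → 0 ≤ x.2 := by
    intro x hx hk
    have h1 : ∀ ε : ℝ, 0 < ε → 0 ≤ x.2 + ε * c := by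
      intro ε hε
      have := hWpos' (x + ε • ((1 : C(K, ℝ)), c)) (W.add_mem hx (W.smul_mem _ hWone))
        (fun k => by
          simp only [Prod.fst_add, Prod.smul_mk, ContinuousMap.add_apply,
            ContinuousMap.smul_apply, ContinuousMap.one_apply, smul_eq_mul, mul_one]
          linarith [hk k])
      simpa using this
    have h2 : Filter.Tendsto (fun ε : ℝ => x.2 + ε * c) (nhdsWithin 0 (Set.Ioi 0))
        (nhds (x.2 + 0 * c)) :=
      ((continuous_const.add (continuous_id.mul continuous_const)).tendsto 0).mono_left
        nhdsWithin_le_nhds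
    rw [zero_mul, add_zero] at h2
    exact ge_of_tendsto h2 (eventually_nhdsWithin_of_forall fun ε hε => h1 ε hε)
  have hWg : ∀ (x : C(K, ℝ) × ℝ) (_ : x ∈ W) (_ : x.fst = 0), x.snd = 0 := by
    intro x hx h0
    have h1 := hWpos x hx (fun k => by rw [h0]; simp)
    have h2 := hWpos (-x) (W.neg_mem hx) (fun k => by rw [Prod.fst_neg, h0]; simp)
    rw [Prod.snd_neg] at h2
    linarith
  let C : PointedCone ℝ C(K, ℝ) :=
    { carrier := {f | ∀ k, 0 ≤ f k}
      add_mem' := fun {f g} hf hg k => add_nonneg (hf k) (hg k)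
      zero_mem' := fun k => le_rfl
      smul_mem' := fun a f hf k => mul_nonneg a.2 (hf k) }
  obtain ⟨L, hL1, hL2⟩ := riesz_extension C W.toLinearPMap
    (fun x hx => hWpos _ (Submodule.mem_graph_toLinearPMap hWg x) hx)
    (fun y => ⟨⟨‖y‖ • (1 : C(K, ℝ)), ⟨‖y‖ • ((1 : C(K, ℝ)), c), W.smul_mem _ hWone, rfl⟩⟩,
      fun k => by
        have := (abs_le.1 (y.norm_coe_le_norm k)).1
        simp only [ContinuousMap.add_apply, ContinuousMap.smul_apply, ContinuousMap.one_apply,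
          smul_eq_mul, mul_one]
        linarith⟩)
  refine ⟨L, fun f hf => hL2 f hf, fun x hx => ?_⟩
  have hxW : x ∈ W := subset_closure (hRS x hx)
  have hd : x.1 ∈ W.map (LinearMap.fst ℝ _ _) := ⟨x, hxW, rfl⟩
  have h1 := hL1 ⟨x.1, hd⟩
  have h2 := Submodule.mem_graph_toLinearPMap hWg ⟨x.1, hd⟩
  have h3 := hWg _ (W.sub_mem h2 hxW) (by simp)
  rw [Prod.snd_sub] at h3
  simp only at h1 h3
  rw [h1]
  exact sub_eq_zero.1 h3

lemma exists_measure [T2Space K] [MeasurableSpace K] [BorelSpace K]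
    (L : C(K, ℝ) →ₗ[ℝ] ℝ) (hL : ∀ f : C(K, ℝ), (∀ k, 0 ≤ f k) → 0 ≤ L f) :
    ∃ μ : Measure K, IsFiniteMeasure μ ∧ ∀ f : C(K, ℝ), L f = ∫ k, f k ∂μ := by
  let Λ0 : CompactlySupportedContinuousMap K ℝ →ₗ[ℝ] ℝ :=
    { toFun := fun f => L f.toContinuousMap
      map_add' := fun f g => L.map_add _ _
      map_smul' := fun a f => L.map_smul a _ }
  let Λ : CompactlySupportedContinuousMap K ℝ →ₚ[ℝ] ℝ :=
    PositiveLinearMap.mk₀ Λ0 (fun f hf => hL _ (fun k => hf k))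
  refine ⟨RealRMK.rieszMeasure Λ, ?_, fun f => ?_⟩
  · infer_instance
  · have := RealRMK.integral_rieszMeasure Λ
      (CompactlySupportedContinuousMap.continuousMapEquiv f)
    exact this.symm

end Functional

/-! ### Part 6: assembling -/

lemma Hn_unique {X : Type} [Fintype X] {p : X → ℝ} (hp : PosProb p) (g : ℝ → ℝ)
    (hg : Continuous g) (h : ∀ α, α ≠ 1 → (1 - α) * g α = Real.log (Zf p α)) : Hn p = g := by
  refine Continuous.ext_on (dense_compl_singleton (1 : ℝ)) hp.Hn_cont hg fun α hα => ?_
  have hα' : (1 - α) ≠ 0 := sub_ne_zero.2 (Ne.symm hα)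
  exact mul_left_cancel₀ hα' ((hp.Hn_mul α).trans (h α hα).symm)

lemma PosProb.prod {X Y : Type} [Fintype X] [Fintype Y] {p : X → ℝ} {q : Y → ℝ}
    (hp : PosProb p) (hq : PosProb q) : PosProb (fun z : X × Y => p z.1 * q z.2) where
  pos z := mul_pos (hp.pos _) (hq.pos _)
  sum := by
    rw [Fintype.sum_prod_type, ← Fintype.sum_mul_sum, hp.sum, hq.sum, mul_one]

lemma Hn_prod {X Y : Type} [Fintype X] [Fintype Y] {p : X → ℝ} {q : Y → ℝ}
    (hp : PosProb p) (hq : PosProb q) :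
    Hn (fun z : X × Y => p z.1 * q z.2) = fun α => Hn p α + Hn q α := by
  refine Hn_unique (hp.prod hq) _ (hp.Hn_cont.add hq.Hn_cont) fun α _ => ?_
  have : Zf (fun z : X × Y => p z.1 * q z.2) α = Zf p α * Zf q α := by
    simp only [Zf]
    rw [Fintype.sum_prod_type, Fintype.sum_mul_sum]
    refine Finset.sum_congr rfl fun x _ => Finset.sum_congr rfl fun y _ => ?_
    exact Real.mul_rpow (hp.pos x).le (hq.pos y).le
  rw [this, Real.log_mul (hp.Zpos α).ne' (hq.Zpos α).ne', mul_add, hp.Hn_mul, hq.Hn_mul]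

lemma IsH.prod_prob {h : ∀ (X : Type) [Fintype X], (X → ℝ) → ℝ} (H : IsH h)
    {X Y : Type} [Fintype X] [Fintype Y] {p : X → ℝ} {q : Y → ℝ}
    (hp : PosProb p) (hq : PosProb q) :
    h (X × Y) (fun z => p z.1 * q z.2) = h X p + h Y q := by
  rw [H.prod X Y p q (fun x => (hp.pos x).le) (fun x => (hq.pos x).le), hp.sum, hq.sum]
  ring

lemma posProb_unit : PosProb (fun _ : Unit => (1 : ℝ)) := ⟨fun _ => one_pos, by simp⟩

lemma Hn_unit : Hn (fun _ : Unit => (1 : ℝ)) = fun _ => 0 :=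
  Hn_unique posProb_unit _ continuous_const fun α _ => by simp [Zf]

lemma posProb_half : PosProb (fun _ : Fin 2 => (1 / 2 : ℝ)) :=
  ⟨fun _ => by norm_num, by simp⟩

lemma Hn_half : Hn (fun _ : Fin 2 => (1 / 2 : ℝ)) = fun _ => Real.log 2 := by
  refine Hn_unique posProb_half _ continuous_const fun α _ => ?_
  have : Zf (fun _ : Fin 2 => (1 / 2 : ℝ)) α = 2 * (1 / 2 : ℝ) ^ α := by simp [Zf]
  rw [this, Real.log_mul two_ne_zero (by positivity), Real.log_rpow (by norm_num), one_div,
    Real.log_inv]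
  ring

/-- The group of difference pairs. -/
def diffGroup {h : ∀ (X : Type) [Fintype X], (X → ℝ) → ℝ} (H : IsH h) :
    AddSubgroup (C(unitInterval, ℝ) × ℝ) where
  carrier := {x | ∃ (X Y : Type) (_ : Fintype X) (_ : Fintype Y) (p : X → ℝ) (q : Y → ℝ),
    PosProb p ∧ PosProb q ∧ (∀ k : unitInterval, x.1 k = (Hn p k - Hn q k) / Real.log 2) ∧
      x.2 = h X p - h Y q}
  add_mem' := by
    rintro x x' ⟨X, Y, _, _, p, q, hp, hq, h1, h2⟩ ⟨X', Y', _, _, p', q', hp', hq', h1', h2'⟩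
    refine ⟨X × X', Y × Y', inferInstance, inferInstance, _, _, hp.prod hp', hq.prod hq', ?_, ?_⟩
    · intro k
      rw [Hn_prod hp hp', Hn_prod hq hq', Prod.fst_add, ContinuousMap.add_apply, h1, h1']
      ring
    · rw [H.prod_prob hp hp', H.prod_prob hq hq', Prod.snd_add, h2, h2']
      ring
  zero_mem' := ⟨Unit, Unit, inferInstance, inferInstance, _, _, posProb_unit, posProb_unit,
    by simp, by simp⟩
  neg_mem' := by
    rintro x ⟨X, Y, _, _, p, q, hp, hq, h1, h2⟩
    refine ⟨Y, X, inferInstance, inferInstance, q, p, hq, hp, fun k => ?_, ?_⟩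
    · rw [Prod.fst_neg, ContinuousMap.neg_apply, h1]; ring
    · rw [Prod.snd_neg, h2]; ring

lemma exists_rep {h : ∀ (X : Type) [Fintype X], (X → ℝ) → ℝ} (H : IsH h) :
    ∃ μ : Measure unitInterval, IsFiniteMeasure μ ∧
      ∀ (X : Type) [Fintype X] (p : X → ℝ), PosProb p →
        h X p = ∫ k : unitInterval, Hn p k / Real.log 2 ∂μ := by
  have hl2 : 0 < Real.log 2 := Real.log_pos one_lt_two
  have hmem : ∀ (X : Type) [Fintype X] (p : X → ℝ) (hp : PosProb p),
      ((⟨fun k : unitInterval => Hn p k / Real.log 2,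
        (hp.Hn_cont.comp continuous_subtype_val).div_const _⟩ : C(unitInterval, ℝ)), h X p) ∈
        diffGroup H := by
    intro X _ p hp
    refine ⟨X, Unit, inferInstance, inferInstance, p, _, hp, posProb_unit, fun k => ?_, ?_⟩
    · rw [Hn_unit, sub_zero]; rfl
    · rw [H.unit, sub_zero]
  obtain ⟨L, hL1, hL2⟩ := exists_functional (diffGroup H) (h (Fin 2) (fun _ => 1 / 2))
    (by
      convert hmem _ _ posProb_half using 2
      ext k
      have e := congrFun Hn_half (k : ℝ)
      change 1 = Hn (fun _ : Fin 2 => (1 / 2 : ℝ)) k / Real.log 2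
      rw [e, div_self hl2.ne'])
    (by
      rintro x ⟨X, Y, _, _, p, q, hp, hq, h1, h2⟩ hk
      rw [h2, sub_nonneg]
      refine core_compare H hp hq fun α h0 h1' => ?_
      have := hk ⟨α, h0, h1'⟩
      rw [h1] at this
      have := (div_pos_iff_of_pos_right hl2).1 this
      simpa using this)
  obtain ⟨μ, hμ, hμ2⟩ := exists_measure L hL1
  refine ⟨μ, hμ, fun X _ p hp => ?_⟩
  have e := hL2 _ (hmem X p hp)
  rw [hμ2] at e
  exact e.symm

lemma sum_support {X : Type} [Fintype X] (v : X → ℝ) [Fintype {x // 0 < v x}]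
    (hv : ∀ x, 0 ≤ v x) (F : ℝ → ℝ) (hF : F 0 = 0) :
    ∑ x, F (v x) = ∑ x : {x // 0 < v x}, F (v x) := by
  classical
  rw [← Finset.sum_subtype (Finset.univ.filter fun x => 0 < v x) (by simp) (fun x => F (v x))]
  refine (Finset.sum_filter_of_ne fun x _ hx => ?_).symm
  refine lt_of_le_of_ne (hv x) fun h => hx ?_
  rw [← h, hF]

lemma posProb_support {X : Type} [Fintype X] (v : X → ℝ) [Fintype {x // 0 < v x}]
    (hv : ∀ x, 0 ≤ v x) (hs : ∑ x, v x = 1) : PosProb (fun x : {x // 0 < v x} => v x) :=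
  ⟨fun x => x.2, (sum_support v hv id rfl).symm.trans hs⟩

lemma renyi_eq {X : Type} [Fintype X] (v : X → ℝ) [Fintype {x // 0 < v x}]
    (hv : ∀ x, 0 ≤ v x) (hs : ∑ x, v x = 1) (k : unitInterval) :
    renyi (ENNReal.ofReal k) v = Hn (fun x : {x // 0 < v x} => v x) k / Real.log 2 := by
  have hp := posProb_support v hv hs
  obtain ⟨k, hk0, hk1⟩ := k
  simp only [renyi, log2, Real.logb]
  by_cases h0 : k = 0
  · subst h0
    have := hp.Hn_mul 0
    simp only [sub_zero, one_mul] at this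
    rw [this]
    simp [Zf]
  have hkpos : 0 < k := lt_of_le_of_ne hk0 (Ne.symm h0)
  rw [if_neg (by simpa using hkpos)]
  by_cases h1 : k = 1
  · subst h1
    rw [if_pos (by simp), hp.Hn_one,
      ← sum_support v hv (fun t => t * Real.log t) (by simp), neg_div, Finset.sum_div]
    simp only [mul_div_assoc]
  · rw [if_neg (by simpa [ENNReal.ofReal_eq_one] using h1), if_neg ENNReal.ofReal_ne_top,
      ENNReal.toReal_ofReal hk0, sum_support v hv (fun t => t ^ k) (Real.zero_rpow h0)]
    have h2 := hp.Hn_mul k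
    have h3 : (1 - k) ≠ 0 := sub_ne_zero.2 (Ne.symm h1)
    rw [Zf] at h2
    rw [← h2]
    field_simp

lemma exists_tau {h : ∀ (X : Type) [Fintype X], (X → ℝ) → ℝ} (H : IsH h) :
    ∃ τ : Measure ℝ≥0∞, IsFiniteMeasure τ ∧
      (∀ (X : Type) [Fintype X] (v : X → ℝ), (∀ x, 0 ≤ v x) → ∑ x, v x = 1 →
        h X v = ∫ α, renyi α v ∂τ) ∧
      h (Fin 2) (fun _ => 1 / 2) = τ.real Set.univ := by
  classical
  obtain ⟨μ, hμ, hrep⟩ := exists_rep H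
  have hl2 : 0 < Real.log 2 := Real.log_pos one_lt_two
  have hcont : Continuous (fun k : unitInterval => ENNReal.ofReal (k : ℝ)) :=
    ENNReal.continuous_ofReal.comp continuous_subtype_val
  have hinj : Function.Injective (fun k : unitInterval => ENNReal.ofReal (k : ℝ)) := by
    intro a b hab
    exact Subtype.ext ((ENNReal.ofReal_eq_ofReal_iff a.2.1 b.2.1).1 hab)
  have hme := (hcont.isClosedEmbedding hinj).measurableEmbedding
  refine ⟨μ.map (fun k : unitInterval => ENNReal.ofReal (k : ℝ)), inferInstance,
    fun X _ v hv hs => ?_, ?_⟩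
  · rw [hme.integral_map]
    have h1 := H.emb {x // 0 < v x} X (fun x => v x) v (Function.Embedding.subtype _)
      (fun x => hv x) (fun x => rfl)
      (fun x hx => ⟨⟨x, lt_of_le_of_ne (hv x) (Ne.symm hx)⟩, rfl⟩)
    rw [← h1, hrep _ _ (posProb_support v hv hs)]
    exact integral_congr_ae (Filter.Eventually.of_forall fun k => (renyi_eq v hv hs k).symm)
  · rw [hrep _ _ posProb_half, Hn_half]
    simp only [div_self hl2.ne', integral_const, smul_eq_mul, mul_one]
    rw [measureReal_def, measureReal_def, hme.map_apply, Set.preimage_univ]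

/-- Classification of monotone derivations at the total mass: every functional
on nonnegative matrices which is invariant under permutations and zero-padding, additive under
direct sums, satisfies the Leibniz rule with respect to the total mass `‖·‖`, vanishes on
`1×1` matrices, and is monotone under conditionally mixing channels is of the stated
barycentric form for some finite positive Borel measure `τ` on `[0,∞]`, which is a
probability measure whenever `Δ((1/2,1/2)) = 1`. -/
theorem monotone_derivation_classification
    (Δ : ∀ (X Y : Type) [Fintype X] [Fintype Y], Matrix X Y ℝ → ℝ)
    (h_inv : ∀ (X Y X' Y' : Type) [Fintype X] [Fintype Y] [Fintype X'] [Fintype Y']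
      (P : Matrix X Y ℝ) (P' : Matrix X' Y' ℝ),
      (∀ x y, 0 ≤ P x y) → Embeds P P' → Δ X Y P = Δ X' Y' P')
    (h_add : ∀ (X Y X' Y' : Type) [Fintype X] [Fintype Y] [Fintype X'] [Fintype Y']
      (P : Matrix X Y ℝ) (Q : Matrix X' Y' ℝ),
      (∀ x y, 0 ≤ P x y) → (∀ x y, 0 ≤ Q x y) →
      Δ (X ⊕ X') (Y ⊕ Y') (Matrix.fromBlocks P 0 0 Q) = Δ X Y P + Δ X' Y' Q)
    (h_leibniz : ∀ (X Y X' Y' : Type) [Fintype X] [Fintype Y] [Fintype X'] [Fintype Y']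
      (P : Matrix X Y ℝ) (Q : Matrix X' Y' ℝ),
      (∀ x y, 0 ≤ P x y) → (∀ x y, 0 ≤ Q x y) →
      Δ (X × X') (Y × Y') (kron P Q) = Δ X Y P * totalMass Q + totalMass P * Δ X' Y' Q)
    (h_scalar : ∀ c : ℝ, 0 ≤ c → Δ (Fin 1) (Fin 1) (Matrix.of fun _ _ => c) = 0)
    (h_mono : ∀ (X Y Y' : Type) [Fintype X] [Fintype Y] [Fintype Y']
      (P : Matrix X Y ℝ) (Q : Matrix X Y' ℝ),
      (∀ x y, 0 ≤ P x y) → CondMixed P Q → Δ X Y P ≤ Δ X Y' Q) :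
    ∃ τ : Measure ℝ≥0∞, IsFiniteMeasure τ ∧
      (∀ (X Y : Type) [Fintype X] [Fintype Y] (P : Matrix X Y ℝ), (∀ x y, 0 ≤ P x y) →
        Δ X Y P = ∑ y ∈ Finset.univ.filter (fun y => 0 < margY P y),
          margY P y * ∫ α, renyi α (condX P y) ∂τ) ∧
      (Δ (Fin 2) (Fin 1) (Matrix.of fun _ _ => (1 / 2 : ℝ)) = 1 →
        IsProbabilityMeasure τ) := by

  have H := hcol_isH Δ h_inv h_add h_leibniz h_scalar h_mono
  obtain ⟨τ, hτ, h1, h2⟩ := exists_tau H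
  refine ⟨τ, hτ, fun X Y _ _ P hP => ?_, fun hhalf => ?_⟩
  · rw [delta_eq_sum Δ h_inv h_add h_scalar h_mono P hP, Finset.sum_filter]
    refine Finset.sum_congr rfl fun y _ => ?_
    have hm0 : 0 ≤ margY P y := Finset.sum_nonneg fun x _ => hP x y
    split_ifs with hy
    · have hc0 : ∀ x, 0 ≤ condX P y x := fun x => div_nonneg (hP x y) hm0
      have hc1 : ∑ x, condX P y x = 1 := by
        simp only [condX]
        rw [← Finset.sum_div]
        exact div_self hy.ne'
      have e := H.smul X (margY P y) (condX P y) hm0 hc0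
      rw [h1 X _ hc0 hc1] at e
      rw [← e]
      congr 1
      ext x
      simp only [condX]
      field_simp
    · have hz : ∀ x, P x y = 0 := by
        have h3 : margY P y = 0 := le_antisymm (not_lt.1 hy) hm0
        intro x
        exact (Finset.sum_eq_zero_iff_of_nonneg fun x _ => hP x y).1 h3 x (Finset.mem_univ x)
      have e := H.smul X 0 (fun _ => 0) le_rfl (fun _ => le_rfl)
      simp only [zero_mul] at e
      simp only [hz]
      exact e
  · have h3 : hcol Δ (Fin 2) (fun _ => 1 / 2) = 1 := by
      refine Eq.trans ?_ hhalf
      refine delta_reindex Δ h_inv (Equiv.refl _) (Equiv.ofUnique Unit (Fin 1)) _ _ ?_ ?_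
      · intro x y; simp
      · intro x y; rfl
    have h4 : τ.real Set.univ = 1 := by rw [← h2]; exact h3
    refine ⟨?_⟩
    rw [measureReal_def] at h4
    exact (ENNReal.toReal_eq_one_iff _).1 h4
end
end

section
/- Let R be a matrix with nonnegative real entries such that for some r ∈ (0,1) the 2×1 column vector (r, 1−r)ᵀ conditionally majorizes R. Then for all matrices P and Q with nonnegative entries whose entries have equal total sums (‖P‖ = ‖Q‖), there exists m ∈ ℕ such that P conditionally majorizes Q ⊗ R^{⊗m}. -/
open MeasureTheory
open scoped ENNReal

noncomputable section

lemma aux_mass_col {X Y : Type*} [Fintype X] [Fintype Y] (P : Matrix X Y ℝ) :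
    totalMass P = ∑ y, ∑ x, P x y := Finset.sum_comm

lemma aux_one_ds {X : Type*} [Fintype X] [DecidableEq X] :
    DoublyStochastic (1 : Matrix X X ℝ) := by
  refine ⟨fun i j => ?_, fun i => ?_, fun j => ?_⟩
  · rw [Matrix.one_apply]
    split_ifs <;> norm_num
  · simp [Matrix.one_apply]
  · simp [Matrix.one_apply]

lemma aux_sum_emb {X X' : Type*} [Fintype X] [Fintype X'] (f : X ↪ X') (u : X → ℝ) (v : X' → ℝ)
    (h : ∀ x, v (f x) = u x) (h0 : ∀ x', v x' ≠ 0 → ∃ x, f x = x') : ∑ x', v x' = ∑ x, u x := by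
  classical
  rw [← Finset.sum_congr rfl (fun x _ => h x), ← Finset.sum_map Finset.univ f v]
  symm
  apply Finset.sum_subset (Finset.subset_univ _)
  intro x' _ hx'
  by_contra hne
  obtain ⟨x, rfl⟩ := h0 x' hne
  exact hx' (by simp)

lemma aux_mixed_reindex {X Y Y' A B B' : Type*} [Fintype X] [Fintype Y] [Fintype Y']
    [Fintype A] [Fintype B] [Fintype B']
    (e : A ≃ X) (f : B ≃ Y) (g : B' ≃ Y') {P : Matrix X Y ℝ} {Q : Matrix X Y' ℝ}
    (h : CondMixed P Q) : CondMixed (P.submatrix e f) (Q.submatrix e g) := by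
  obtain ⟨k, S, D, hS, hD, hD1, rfl⟩ := h
  refine ⟨k, fun i => (S i).submatrix e e, fun i => (D i).submatrix f g, ?_, ?_, ?_, ?_⟩
  · intro i
    refine ⟨fun a b => (hS i).1 _ _, fun a => ?_, fun a => ?_⟩
    · simp only [Matrix.submatrix_apply]
      rw [e.sum_comp (fun j => S i (e a) j)]
      exact (hS i).2.1 _
    · simp only [Matrix.submatrix_apply]
      rw [e.sum_comp (fun j => S i j (e a))]
      exact (hS i).2.2 _
  · intro i a b
    exact hD _ _ _
  · intro a
    simp only [Matrix.submatrix_apply]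
    rw [g.sum_comp (fun b => ∑ i, D i (f a) b)]
    exact hD1 _
  · ext a b
    simp only [Matrix.submatrix_mul_equiv, Matrix.sum_apply, Matrix.submatrix_apply]

/-- Conditional majorization from an embedding into arbitrary finite types. -/
lemma aux_maj_of_types {X Y X' Y' A B B' : Type*} [Fintype X] [Fintype Y] [Fintype X'] [Fintype Y']
    [Fintype A] [Fintype B] [Fintype B']
    {P : Matrix X Y ℝ} {Q : Matrix X' Y' ℝ} (P' : Matrix A B ℝ) (Q' : Matrix A B' ℝ)
    (hP : Embeds P P') (hQ : Embeds Q Q') (h : CondMixed P' Q') : CondMajorizes P Q := by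
  refine ⟨Fintype.card A, Fintype.card B, Fintype.card B',
    P'.submatrix (Fintype.equivFin A).symm (Fintype.equivFin B).symm,
    Q'.submatrix (Fintype.equivFin A).symm (Fintype.equivFin B').symm, ?_, ?_,
    aux_mixed_reindex _ _ _ h⟩
  · obtain ⟨f, g, h1, h2⟩ := hP
    refine ⟨f.trans (Fintype.equivFin A).toEmbedding, g.trans (Fintype.equivFin B).toEmbedding,
      fun x y => by simp [h1], fun x y hxy => ?_⟩
    obtain ⟨⟨a, ha⟩, b, hb⟩ := h2 _ _ hxy
    exact ⟨⟨a, by simp [ha]⟩, b, by simp [hb]⟩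
  · obtain ⟨f, g, h1, h2⟩ := hQ
    refine ⟨f.trans (Fintype.equivFin A).toEmbedding, g.trans (Fintype.equivFin B').toEmbedding,
      fun x y => by simp [h1], fun x y hxy => ?_⟩
    obtain ⟨⟨a, ha⟩, b, hb⟩ := h2 _ _ hxy
    exact ⟨⟨a, by simp [ha]⟩, b, by simp [hb]⟩

/-- The doubly stochastic matrix sending everything on `X` to the distribution `q`. -/
def auxS (X : Type*) {X' : Type*} [Fintype X] [Fintype X'] (q : X' → ℝ) :
    Matrix (X ⊕ (X' ⊕ Unit)) (X ⊕ (X' ⊕ Unit)) ℝ :=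
  fun a b =>
    let v : ℝ := Sum.elim (fun _ => 0) (Sum.elim q (fun _ => 0)) a
    Sum.elim (fun _ => v)
      (fun _ => (1 - Fintype.card X * v) / (Fintype.card X' + 1)) b

lemma auxS_ds {X X' : Type*} [Fintype X] [Fintype X'] (q : X' → ℝ) (h0 : ∀ x, 0 ≤ q x)
    (h1 : ∑ x, q x = 1) (hq : ∀ x, Fintype.card X * q x ≤ 1) : DoublyStochastic (auxS X q) := by
  have hc : (Fintype.card X' + 1 : ℝ) ≠ 0 := by positivity
  refine ⟨?_, ?_, ?_⟩
  · rintro (a | a | a) (b | b) <;> simp only [auxS, Sum.elim_inl, Sum.elim_inr] <;>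
      first
      | exact le_refl _
      | exact h0 _
      | exact div_nonneg (by linarith [hq a]) (by positivity)
      | (simp; positivity)
  · intro a
    simp only [auxS, Fintype.sum_sum_type, Sum.elim_inl, Sum.elim_inr, Finset.sum_const,
      Finset.card_univ, nsmul_eq_mul, Fintype.card_sum, Fintype.card_unit, Nat.cast_add, Nat.cast_one]
    rw [mul_div_cancel₀ _ hc]
    ring
  · rintro (b | b)
    · simp [auxS, h1]
    · simp only [auxS, Fintype.sum_sum_type, Sum.elim_inl, Sum.elim_inr, ← Finset.sum_div,
        Finset.sum_sub_distrib, ← Finset.mul_sum, h1]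
      simp [hc]
      try field_simp
      try ring

lemma aux_embeds_left {X Y Z : Type*} [Fintype X] [Fintype Y] [Fintype Z] (P : Matrix X Y ℝ) :
    Embeds P (Matrix.of fun (a : X ⊕ Z) b => Sum.elim (fun x => P x b) (fun _ => 0) a) := by
  refine ⟨Function.Embedding.inl, Function.Embedding.refl _, fun x y => rfl, ?_⟩
  rintro (a | a) b h
  · exact ⟨⟨a, rfl⟩, b, rfl⟩
  · exact absurd rfl h

lemma aux_key {X Y X' Y' : Type*} [Fintype X] [Fintype Y] [Fintype X'] [Fintype Y']
    (P : Matrix X Y ℝ) (Q : Matrix X' Y' ℝ) (hP : ∀ i j, 0 ≤ P i j) (hQ : ∀ i j, 0 ≤ Q i j)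
    (hM : totalMass P = totalMass Q)
    (hb : ∀ x b, Fintype.card X * Q x b ≤ ∑ x, Q x b) : CondMajorizes P Q := by
  classical
  by_cases h0 : totalMass P = 0
  · have zP : ∀ i j, P i j = 0 := by
      intro i j
      have h := h0
      rw [totalMass, Finset.sum_eq_zero_iff_of_nonneg
        (fun i _ => Finset.sum_nonneg fun j _ => hP i j)] at h
      have := h i (Finset.mem_univ _)
      rw [Finset.sum_eq_zero_iff_of_nonneg (fun j _ => hP i j)] at this
      exact this j (Finset.mem_univ _)
    have zQ : ∀ i j, Q i j = 0 := by
      intro i j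
      have h := hM.symm.trans h0
      rw [totalMass, Finset.sum_eq_zero_iff_of_nonneg
        (fun i _ => Finset.sum_nonneg fun j _ => hQ i j)] at h
      have := h i (Finset.mem_univ _)
      rw [Finset.sum_eq_zero_iff_of_nonneg (fun j _ => hQ i j)] at this
      exact this j (Finset.mem_univ _)
    refine aux_maj_of_types (A := X ⊕ X') (B := Y) (B' := Option Y') 0 0 ?_ ?_ ?_
    · exact ⟨Function.Embedding.inl, Function.Embedding.refl _, fun x y => (zP x y).symm,
        fun x y h => absurd rfl h⟩
    · exact ⟨Function.Embedding.inr, Function.Embedding.some, fun x y => (zQ x y).symm,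
        fun x y h => absurd rfl h⟩
    · refine ⟨1, fun _ => 1, fun _ => Matrix.of fun _ b => if b = none then 1 else 0, ?_, ?_, ?_, ?_⟩
      · intro _
        exact aux_one_ds
      · intro _ _ b
        simp only [Matrix.of_apply]
        split_ifs <;> norm_num
      · intro a
        simp
      · ext a b
        simp
  · set M := totalMass P with hMdef
    have hMpos : 0 < M := lt_of_le_of_ne
      (Finset.sum_nonneg fun i _ => Finset.sum_nonneg fun j _ => hP i j) (Ne.symm h0)
    let μ : Y' → ℝ := fun b => ∑ x, Q x b
    have hμ0 : ∀ b, 0 ≤ μ b := fun b => Finset.sum_nonneg fun x _ => hQ x b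
    have hμM : ∑ b, μ b = M := by
      rw [hM, aux_mass_col]
    have hS : ∀ b, ∃ S : Matrix (X ⊕ (X' ⊕ Unit)) (X ⊕ (X' ⊕ Unit)) ℝ, DoublyStochastic S ∧
        ∀ a x, S a (Sum.inl x) * μ b =
          Sum.elim (fun _ => 0) (Sum.elim (fun x' => Q x' b) (fun _ => 0)) a := by
      intro b
      by_cases hb0 : μ b = 0
      · refine ⟨1, aux_one_ds, ?_⟩
        · have hz : ∀ x, Q x b = 0 := fun x =>
            (Finset.sum_eq_zero_iff_of_nonneg (fun x _ => hQ x b)).1 hb0 x (Finset.mem_univ _)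
          rintro (a | a | a) x <;> simp [hb0, hz]
      · have hbp : 0 < μ b := lt_of_le_of_ne (hμ0 b) (Ne.symm hb0)
        refine ⟨auxS X (fun x' => Q x' b / μ b), auxS_ds _ (fun x => div_nonneg (hQ _ _) (hμ0 b))
          ?_ ?_, ?_⟩
        · rw [← Finset.sum_div]
          exact div_self hb0
        · intro x
          rw [← mul_div_assoc, div_le_one hbp]
          exact hb x b
        · rintro (a | a | a) x <;> simp [auxS, hb0]
    choose S hSd hSq using hS
    let e := Fintype.equivFin Y'
    refine aux_maj_of_types (A := X ⊕ (X' ⊕ Unit)) (B := Y) (B' := Y')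
      (Matrix.of fun a b => Sum.elim (fun x => P x b) (fun _ => 0) a)
      (Matrix.of fun a b => Sum.elim (fun _ => 0) (Sum.elim (fun x' => Q x' b) (fun _ => 0)) a)
      (aux_embeds_left P) ?_ ?_
    · refine ⟨Function.Embedding.inl.trans Function.Embedding.inr, Function.Embedding.refl _,
        fun x y => rfl, ?_⟩
      rintro (a | a | a) b h
      · exact absurd rfl h
      · exact ⟨⟨a, rfl⟩, b, rfl⟩
      · exact absurd rfl h
    · refine ⟨Fintype.card Y', fun i => S (e.symm i),
        fun i => Matrix.of fun _ b => if b = e.symm i then μ b / M else 0, fun i => hSd _, ?_, ?_, ?_⟩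
      · intro i a b
        simp only [Matrix.of_apply]
        split_ifs
        · exact div_nonneg (hμ0 b) hMpos.le
        · exact le_refl _
      · intro a
        have : ∀ b, ∑ i, (if b = e.symm i then μ b / M else 0) = μ b / M := by
          intro b
          rw [e.symm.sum_comp (fun b' => if b = b' then μ b / M else 0)]
          simp
        simp only [Matrix.of_apply]
        rw [Finset.sum_congr rfl (fun b _ => this b), ← Finset.sum_div, hμM, div_self h0]
      · ext a b
        rw [Matrix.sum_apply]
        simp only [Matrix.mul_apply, Matrix.of_apply, mul_ite, mul_zero, Fintype.sum_sum_type, Sum.elim_inl,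
          Sum.elim_inr, Finset.sum_const_zero, add_zero]
        rw [e.symm.sum_comp (fun b' => ∑ y, if b = b' then
          (∑ x, S b' a (Sum.inl x) * P x y) * (μ b / M) else 0)]
        rw [Finset.sum_eq_single b (fun b' _ hne => by simp [hne.symm]) (by simp)]
        simp only [if_true]
        rw [← Finset.sum_mul, Finset.sum_comm]
        have : ∀ x y, S b a (Sum.inl x) * P x y * (μ b / M) =
            Sum.elim (fun _ => 0) (Sum.elim (fun x' => Q x' b) (fun _ => 0)) a / M * P x y := by
          intro x y
          rw [← hSq b a x]
          ring
        simp only [Finset.sum_mul, this]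
        simp only [← Finset.mul_sum]
        change _ = _ / M * M
        field_simp

/-- Column entries bounded by a fraction of the column sum. -/
def AuxGood {X Y : Type*} [Fintype X] (c : ℝ) (P : Matrix X Y ℝ) : Prop :=
  ∀ x y, P x y ≤ c * ∑ x, P x y

lemma aux_mixed {X Y Y' : Type*} [Fintype X] [Fintype Y] [Fintype Y'] {c : ℝ}
    {P : Matrix X Y ℝ} {Q : Matrix X Y' ℝ} (h : CondMixed P Q) (hc : AuxGood c P) :
    AuxGood c Q ∧ totalMass Q = totalMass P := by
  obtain ⟨k, S, D, hS, hD, hD1, rfl⟩ := h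
  have hcol : ∀ i y, ∑ x, (S i * P) x y = ∑ x, P x y := by
    intro i y
    simp only [Matrix.mul_apply]
    rw [Finset.sum_comm]
    simp only [← Finset.sum_mul, (hS i).2.2, one_mul]
  have hcol2 : ∀ y', ∑ x, (∑ i, S i * P * D i) x y' = ∑ i, ∑ y, (∑ x, P x y) * D i y y' := by
    intro y'
    simp only [Matrix.sum_apply]
    rw [Finset.sum_comm]
    refine Finset.sum_congr rfl fun i _ => ?_
    simp only [Matrix.mul_apply (M := S i * P)]
    rw [Finset.sum_comm]
    refine Finset.sum_congr rfl fun y _ => ?_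
    rw [← Finset.sum_mul, hcol]
  constructor
  · intro x y'
    rw [hcol2, Matrix.sum_apply, Finset.mul_sum]
    refine Finset.sum_le_sum fun i _ => ?_
    rw [Matrix.mul_apply, Finset.mul_sum]
    refine Finset.sum_le_sum fun y _ => ?_
    rw [← mul_assoc]
    refine mul_le_mul_of_nonneg_right ?_ (hD _ _ _)
    rw [Matrix.mul_apply]
    calc ∑ z, S i x z * P z y ≤ ∑ z, S i x z * (c * ∑ x, P x y) :=
          Finset.sum_le_sum fun z _ => mul_le_mul_of_nonneg_left (hc z y) ((hS i).1 _ _)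
      _ = c * ∑ x, P x y := by rw [← Finset.sum_mul, (hS i).2.1, one_mul]
  · rw [aux_mass_col, Finset.sum_congr rfl (fun y _ => hcol2 y), aux_mass_col]
    have : ∀ y', ∑ i, ∑ y, (∑ x, P x y) * D i y y' = ∑ y, (∑ x, P x y) * ∑ i, D i y y' := by
      intro y'
      rw [Finset.sum_comm]
      simp only [Finset.mul_sum]
    simp only [this]
    rw [Finset.sum_comm]
    simp only [← Finset.mul_sum, hD1, mul_one]

lemma aux_embeds_mass {X Y X' Y' : Type*} [Fintype X] [Fintype Y] [Fintype X'] [Fintype Y']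
    {P : Matrix X Y ℝ} {P' : Matrix X' Y' ℝ} (h : Embeds P P') : totalMass P' = totalMass P := by
  obtain ⟨f, g, h1, h2⟩ := h
  rw [totalMass, totalMass]
  refine aux_sum_emb f _ _ (fun x => ?_) (fun x' hx' => ?_)
  · exact aux_sum_emb g _ _ (fun y => h1 x y) (fun y' hy' => (h2 _ _ hy').2)
  · obtain ⟨y, _, hy⟩ := Finset.exists_ne_zero_of_sum_ne_zero hx'
    exact (h2 _ _ hy).1

lemma aux_good_of_embeds {X Y X' Y' : Type*} [Fintype X] [Fintype Y] [Fintype X'] [Fintype Y']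
    {P : Matrix X Y ℝ} {P' : Matrix X' Y' ℝ} {c : ℝ} (h : Embeds P P') (hc : AuxGood c P') :
    AuxGood c P := by
  obtain ⟨f, g, h1, h2⟩ := h
  intro x y
  rw [← h1, ← aux_sum_emb f (fun x => P x y) (fun x' => P' x' (g y)) (fun x => h1 x y)
    (fun x' hx' => (h2 _ _ hx').1)]
  exact hc _ _

lemma aux_embeds_good {X Y X' Y' : Type*} [Fintype X] [Fintype Y] [Fintype X'] [Fintype Y']
    {P : Matrix X Y ℝ} {P' : Matrix X' Y' ℝ} {c : ℝ} (h : Embeds P P') (hP : ∀ x y, 0 ≤ P x y)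
    (h0 : 0 ≤ c) (hc : AuxGood c P) : AuxGood c P' := by
  obtain ⟨f, g, h1, h2⟩ := h
  have hP' : ∀ x y, 0 ≤ P' x y := by
    intro x y
    by_contra hne
    obtain ⟨⟨a, rfl⟩, b, rfl⟩ := h2 x y (fun h => hne h.ge)
    exact hne (by rw [h1]; exact hP _ _)
  intro x y
  by_cases hz : P' x y = 0
  · rw [hz]
    exact mul_nonneg h0 (Finset.sum_nonneg fun x _ => hP' x y)
  · obtain ⟨⟨a, rfl⟩, b, rfl⟩ := h2 x y hz
    rw [h1, aux_sum_emb f (fun x => P x b) (fun x' => P' x' (g b)) (fun x => h1 x b)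
      (fun x' hx' => (h2 _ _ hx').1)]
    exact hc _ _

lemma aux_kron_col {X Y X' Y' : Type*} [Fintype X] [Fintype X']
    (Q : Matrix X Y ℝ) (R : Matrix X' Y' ℝ) (m : ℕ) (y : Y × (Fin m → Y')) :
    ∑ x, kron Q (kronPow R m) x y = (∑ x, Q x y.1) * ∏ i, ∑ x, R x (y.2 i) := by
  classical
  rw [Finset.prod_univ_sum, Fintype.piFinset_univ, Finset.sum_mul_sum, Fintype.sum_prod_type]
  rfl

lemma aux_kron_mass {X Y X' Y' : Type*} [Fintype X] [Fintype X'] [Fintype Y] [Fintype Y']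
    (Q : Matrix X Y ℝ) (R : Matrix X' Y' ℝ) (m : ℕ) :
    totalMass (kron Q (kronPow R m)) = totalMass Q * totalMass R ^ m := by
  classical
  rw [aux_mass_col, Finset.sum_congr rfl (fun y _ => aux_kron_col Q R m y),
    Fintype.sum_prod_type]
  simp only
  rw [← Finset.sum_mul_sum, aux_mass_col Q]
  congr 1
  have := Finset.prod_univ_sum (fun _ : Fin m => (Finset.univ : Finset Y'))
    (fun _ y => ∑ x, R x y)
  rw [Fintype.piFinset_univ] at this
  rw [← this, aux_mass_col R]
  simp

/-- Power universality: if `(r, 1-r)ᵀ` conditionally majorizes `R` for some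
`r ∈ (0,1)`, then for all nonnegative matrices `P` and `Q` of equal total mass there is
`m ∈ ℕ` such that `P` conditionally majorizes `Q ⊗ R^{⊗m}`. -/
theorem power_universal (dR nR : ℕ) (R : Matrix (Fin dR) (Fin nR) ℝ)
    (hR : ∀ i j, 0 ≤ R i j) (r : ℝ) (hr : r ∈ Set.Ioo (0 : ℝ) 1)
    (hmaj : CondMajorizes
      (Matrix.of fun (i : Fin 2) (_ : Fin 1) => if i = 0 then r else 1 - r) R) :
    ∀ (dP nP dQ nQ : ℕ) (P : Matrix (Fin dP) (Fin nP) ℝ) (Q : Matrix (Fin dQ) (Fin nQ) ℝ),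
      (∀ i j, 0 ≤ P i j) → (∀ i j, 0 ≤ Q i j) → totalMass P = totalMass Q →
      ∃ m : ℕ, CondMajorizes P (kron Q (kronPow R m)) := by
  obtain ⟨hr0, hr1⟩ := hr
  obtain ⟨m₀, n₀, n₁, A, B, hA, hB, hAB⟩ := hmaj
  have hc0 : 0 ≤ max r (1 - r) := le_max_of_le_left hr0.le
  have hc1 : max r (1 - r) < 1 := max_lt hr1 (by linarith)
  have hnn : ∀ (i : Fin 2) (j : Fin 1), 0 ≤ (Matrix.of fun (i : Fin 2) (_ : Fin 1) =>
      if i = 0 then r else 1 - r) i j := by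
    intro i j
    simp only [Matrix.of_apply]
    split_ifs <;> linarith
  have hg0 : AuxGood (max r (1 - r)) (Matrix.of fun (i : Fin 2) (_ : Fin 1) =>
      if i = 0 then r else 1 - r) := by
    intro i j
    simp only [Matrix.of_apply, Fin.sum_univ_two]
    split_ifs <;> simp_all
  obtain ⟨hgB, hmB⟩ := aux_mixed hAB (aux_embeds_good hA hnn hc0 hg0)
  have hgR := aux_good_of_embeds hB hgB
  have hmR : totalMass R = 1 := by
    rw [← aux_embeds_mass hB, hmB, aux_embeds_mass hA]
    simp [totalMass, Fin.sum_univ_two]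
  set c := max r (1 - r) with hcdef
  intro dP nP dQ nQ P Q hP hQ hM
  have hlim : Filter.Tendsto (fun m : ℕ => (dP : ℝ) * c ^ m) Filter.atTop (nhds ((dP : ℝ) * 0)) :=
    (tendsto_pow_atTop_nhds_zero_of_lt_one hc0 hc1).const_mul _
  rw [mul_zero] at hlim
  obtain ⟨m, hm⟩ := (hlim.eventually (gt_mem_nhds one_pos)).exists
  refine ⟨m, aux_key P _ hP ?_ ?_ ?_⟩
  · intro i j
    change 0 ≤ Q i.1 j.1 * ∏ k, R (i.2 k) (j.2 k)
    exact mul_nonneg (hQ _ _) (Finset.prod_nonneg fun _ _ => hR _ _)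
  · rw [aux_kron_mass, hmR, one_pow, mul_one, hM]
  · intro x y
    rw [aux_kron_col, Fintype.card_fin]
    have hq : Q x.1 y.1 ≤ ∑ x, Q x y.1 :=
      Finset.single_le_sum (f := fun x => Q x y.1) (fun x _ => hQ x y.1) (Finset.mem_univ _)
    have hprod : ∏ i, R (x.2 i) (y.2 i) ≤ c ^ m * ∏ i, ∑ x, R x (y.2 i) := by
      calc ∏ i, R (x.2 i) (y.2 i) ≤ ∏ i, (c * ∑ x, R x (y.2 i)) :=
            Finset.prod_le_prod (fun i _ => hR _ _) (fun i _ => hgR _ _)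
        _ = _ := by simp [Finset.prod_mul_distrib]
    have hs : 0 ≤ ∑ x, Q x y.1 := Finset.sum_nonneg fun x _ => hQ x y.1
    have ht : 0 ≤ ∏ i, ∑ x, R x (y.2 i) :=
      Finset.prod_nonneg fun i _ => Finset.sum_nonneg fun x _ => hR _ _
    have h1 : Q x.1 y.1 * ∏ i, R (x.2 i) (y.2 i) ≤
        (∑ x, Q x y.1) * (c ^ m * ∏ i, ∑ x, R x (y.2 i)) :=
      mul_le_mul hq hprod (Finset.prod_nonneg fun i _ => hR _ _) hs
    change (dP : ℝ) * (Q x.1 y.1 * ∏ i, R (x.2 i) (y.2 i)) ≤ _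
    calc (dP : ℝ) * (Q x.1 y.1 * ∏ i, R (x.2 i) (y.2 i))
        ≤ dP * ((∑ x, Q x y.1) * (c ^ m * ∏ i, ∑ x, R x (y.2 i))) :=
          mul_le_mul_of_nonneg_left h1 (Nat.cast_nonneg _)
      _ = (dP * c ^ m) * ((∑ x, Q x y.1) * ∏ i, ∑ x, R x (y.2 i)) := by ring
      _ ≤ 1 * ((∑ x, Q x y.1) * ∏ i, ∑ x, R x (y.2 i)) :=
          mul_le_mul_of_nonneg_right hm.le (mul_nonneg hs ht)
      _ = _ := one_mul _
end
end

section
/- Let τ be a Borel probability measure on [0,∞] such that either (a) supp(τ) ⊆ [0,1], or (b) supp(τ) ⊆ [0,1] ∪ {α*} for some α* ∈ (1,∞], τ({1}) = 0, and ∫_{[0,∞]} α/(1−α) dτ(α) ≤ 0 (with the convention α/(1−α) = −1 at α = ∞). Then for all joint probability distributions P and Q such that Q is obtained from P by a conditionally mixing channel, H_{−∞,τ}(X|Y)_P ≤ H_{−∞,τ}(X′|Y′)_Q, where H_{−∞,τ}(X|Y)_P = min_{y: P_Y(y)>0} ∫_{[0,∞]} H_α(P_{X|Y=y}) dτ(α).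 -/
open MeasureTheory
open scoped ENNReal

noncomputable section

section Helpers

variable {X J : Type} [Fintype X] [Fintype J]

lemma aux_jensen (φ : ℝ → ℝ) (hφ : ConcaveOn ℝ (Set.Ici 0) φ) (θ : J → ℝ)
    (hθ : ∀ j, 0 ≤ θ j) (hθ1 : ∑ j, θ j = 1) (S : J → Matrix X X ℝ)
    (hS : ∀ j, DoublyStochastic (S j)) (v : J → X → ℝ) (hv : ∀ j x, 0 ≤ v j x) :
    ∑ j, θ j * ∑ x, φ (v j x) ≤ ∑ x, φ (∑ j, θ j * ∑ x', S j x x' * v j x') := by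
  have h1 : ∀ x, ∑ j, ∑ x', θ j * S j x x' * φ (v j x') ≤
      φ (∑ j, θ j * ∑ x', S j x x' * v j x') := by
    intro x
    have := hφ.le_map_sum (t := (Finset.univ : Finset (J × X)))
      (w := fun a => θ a.1 * S a.1 x a.2) (p := fun a => v a.1 a.2)
      (fun a _ => mul_nonneg (hθ _) ((hS a.1).1 _ _))
      (by rw [Fintype.sum_prod_type]; simp only [← Finset.mul_sum, (hS _).2.1, mul_one, hθ1])
      (fun a _ => hv _ _)
    rw [Fintype.sum_prod_type, Fintype.sum_prod_type] at this
    simpa [smul_eq_mul, Finset.mul_sum, mul_assoc] using this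
  refine le_trans (le_of_eq ?_) (Finset.sum_le_sum fun x _ => h1 x)
  rw [Finset.sum_comm]
  refine Finset.sum_congr rfl fun j _ => ?_
  rw [Finset.sum_comm, Finset.mul_sum]
  refine Finset.sum_congr rfl fun x _ => ?_
  rw [← Finset.sum_mul, ← Finset.mul_sum, (hS j).2.2, mul_one]

lemma aux_logJensen (θ : J → ℝ) (hθ : ∀ j, 0 ≤ θ j) (hθ1 : ∑ j, θ j = 1)
    (Z : J → ℝ) (hZ : ∀ j, 0 < Z j) :
    ∑ j, θ j * log2 (Z j) ≤ log2 (∑ j, θ j * Z j) := by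
  have := strictConcaveOn_log_Ioi.concaveOn.le_map_sum (t := Finset.univ) (w := θ) (p := Z)
    (fun j _ => hθ j) hθ1 (fun j _ => hZ j)
  simp only [smul_eq_mul] at this
  simp only [log2, Real.logb, ← mul_div_assoc, ← Finset.sum_div]
  exact div_le_div_of_nonneg_right this (Real.log_pos (by norm_num)).le

lemma aux_exists_pos {p : X → ℝ} (hp : IsProbVec p) : ∃ x, 0 < p x := by
  by_contra! h
  have : ∑ x, p x ≤ 0 := Finset.sum_nonpos fun x _ => h x
  linarith [hp.2]

lemma aux_le_one {p : X → ℝ} (hp : IsProbVec p) (x : X) : p x ≤ 1 := by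
  rw [← hp.2]; exact Finset.single_le_sum (fun i _ => hp.1 i) (Finset.mem_univ x)

lemma aux_sum_rpow_pos {p : X → ℝ} (hp : IsProbVec p) (a : ℝ) : 0 < ∑ x, p x ^ a := by
  obtain ⟨x, hx⟩ := aux_exists_pos hp
  exact Finset.sum_pos' (fun i _ => Real.rpow_nonneg (hp.1 i) _)
    ⟨x, Finset.mem_univ _, Real.rpow_pos_of_pos hx _⟩

lemma aux_concave_ind : ConcaveOn ℝ (Set.Ici (0:ℝ)) (fun t : ℝ => if 0 < t then (1:ℝ) else 0) := by
  refine ⟨convex_Ici 0, ?_⟩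
  intro x hx y hy a b ha hb hab
  simp only [Set.mem_Ici, smul_eq_mul] at *
  rcases hx.lt_or_eq with h1 | h1 <;> rcases hy.lt_or_eq with h2 | h2
  · have : 0 < a * x + b * y := by
      rcases ha.lt_or_eq with h | h
      · have := mul_pos h h1
        have := mul_nonneg hb hy
        linarith
      · have : b = 1 := by linarith
        subst h; subst this; simpa using h2
    simp [*]
  · subst h2
    rcases ha.lt_or_eq with h | h
    · have := mul_pos h h1
      simp only [h1, this, mul_zero, add_zero, if_true]; simp; linarith
    · subst h; simp
  · subst h1
    rcases hb.lt_or_eq with h | h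
    · have := mul_pos h h2
      simp only [h2, this, mul_zero, zero_add, if_true]; simp; linarith
    · subst h; simp
  · subst h1; subst h2; simp

lemma aux_card (p : X → ℝ) :
    ((Nat.card {x : X // 0 < p x} : ℕ) : ℝ) = ∑ x, (if 0 < p x then (1:ℝ) else 0) := by
  classical
  rw [Nat.card_eq_fintype_card, Fintype.card_subtype]
  simp

lemma aux_log2_mono {x y : ℝ} (hx : 0 < x) (h : x ≤ y) : log2 x ≤ log2 y :=
  Real.logb_le_logb_of_le (by norm_num) hx h

lemma aux_mix_lt_one (α : ℝ≥0∞) (hα : α < 1) (θ : J → ℝ)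
    (hθ : ∀ j, 0 ≤ θ j) (hθ1 : ∑ j, θ j = 1) (S : J → Matrix X X ℝ)
    (hS : ∀ j, DoublyStochastic (S j)) (pj : J → X → ℝ) (hpj : ∀ j, IsProbVec (pj j))
    (p : X → ℝ) (hp : IsProbVec p) (n : ℝ) (hn : 0 < n) (nj : J → ℝ) (hnj : ∀ j, 0 < nj j)
    (hmix : ∀ x, p x / n = ∑ j, θ j * ∑ x', S j x x' * (pj j x' / nj j)) :
    ∑ j, θ j * renyi α (pj j) + aRatio α * (log2 n - ∑ j, θ j * log2 (nj j)) ≤ renyi α p := by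
  have hv : ∀ j x, 0 ≤ pj j x / nj j := fun j x => div_nonneg ((hpj j).1 x) (hnj j).le
  by_cases h0 : α = 0
  · subst h0
    have h := aux_jensen _ aux_concave_ind θ hθ hθ1 S hS _ hv
    simp only [← hmix] at h
    have e1 : ∀ j x, (0 < pj j x / nj j) ↔ 0 < pj j x := fun j x => div_pos_iff_of_pos_right (hnj j)
    have e2 : ∀ x, (0 < p x / n) ↔ 0 < p x := fun x => div_pos_iff_of_pos_right hn
    simp only [e1, e2, ← aux_card] at h
    have hpos : ∀ j, (0:ℝ) < (Nat.card {x : X // 0 < pj j x} : ℕ) := by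
      intro j
      obtain ⟨x, hx⟩ := aux_exists_pos (hpj j)
      have : Nonempty {x : X // 0 < pj j x} := ⟨⟨x, hx⟩⟩
      exact_mod_cast Nat.card_pos
    have h2 := aux_logJensen θ hθ hθ1 _ hpos
    have hex : (0:ℝ) < ∑ j, θ j * (Nat.card {x : X // 0 < pj j x} : ℕ) := by
      have : ∑ j, θ j * 1 ≤ ∑ j, θ j * (Nat.card {x : X // 0 < pj j x} : ℕ) := by
        refine Finset.sum_le_sum fun j _ => mul_le_mul_of_nonneg_left ?_ (hθ j)
        have := hpos j
        exact_mod_cast this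
      simp only [mul_one, hθ1] at this
      linarith
    simp only [renyi, aRatio]
    simp [-Nat.card_eq_fintype_card]
    exact h2.trans (aux_log2_mono hex h)
  · have htop : α ≠ ⊤ := (hα.trans ENNReal.one_lt_top).ne
    have h1 : α ≠ 1 := hα.ne
    simp only [renyi, aRatio, h0, h1, htop, if_false]
    obtain ⟨a, ha⟩ : ∃ a, a = α.toReal := ⟨_, rfl⟩
    have ha0 : 0 < a := ha ▸ ENNReal.toReal_pos h0 htop
    have ha1 : a < 1 := by
      rw [ha]; simpa using (ENNReal.toReal_lt_toReal htop ENNReal.one_ne_top).2 hα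
    rw [← ha]
    have h := aux_jensen _ (Real.concaveOn_rpow ha0.le ha1.le) θ hθ hθ1 S hS _ hv
    simp only [← hmix] at h
    have e1 : ∀ j, ∑ x, (pj j x / nj j) ^ a = (∑ x, pj j x ^ a) / nj j ^ a := by
      intro j
      rw [Finset.sum_div]
      exact Finset.sum_congr rfl fun x _ => Real.div_rpow ((hpj j).1 x) (hnj j).le _
    have e2 : ∑ x, (p x / n) ^ a = (∑ x, p x ^ a) / n ^ a := by
      rw [Finset.sum_div]
      exact Finset.sum_congr rfl fun x _ => Real.div_rpow (hp.1 x) hn.le _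
    simp only [e1, e2] at h
    have hpos : ∀ j, 0 < (∑ x, pj j x ^ a) / nj j ^ a := fun j =>
      div_pos (aux_sum_rpow_pos (hpj j) a) (Real.rpow_pos_of_pos (hnj j) _)
    have h2 := aux_logJensen θ hθ hθ1 _ hpos
    obtain ⟨j0, hj0⟩ := aux_exists_pos (p := θ) ⟨hθ, hθ1⟩
    have hex : 0 < ∑ j, θ j * ((∑ x, pj j x ^ a) / nj j ^ a) :=
      Finset.sum_pos' (fun j _ => mul_nonneg (hθ j) (hpos j).le)
        ⟨j0, Finset.mem_univ _, mul_pos hj0 (hpos j0)⟩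
    have h3 := h2.trans (aux_log2_mono hex h)
    have l1 : ∀ j, log2 ((∑ x, pj j x ^ a) / nj j ^ a) =
        log2 (∑ x, pj j x ^ a) - a * log2 (nj j) := by
      intro j
      simp only [log2]
      rw [Real.logb_div (aux_sum_rpow_pos (hpj j) a).ne' (Real.rpow_pos_of_pos (hnj j) _).ne',
        Real.logb_rpow_eq_mul_logb_of_pos (hnj j)]
    have l2 : log2 ((∑ x, p x ^ a) / n ^ a) = log2 (∑ x, p x ^ a) - a * log2 n := by
      simp only [log2]
      rw [Real.logb_div (aux_sum_rpow_pos hp a).ne' (Real.rpow_pos_of_pos hn _).ne',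
        Real.logb_rpow_eq_mul_logb_of_pos hn]
    simp only [l1, l2, mul_sub, Finset.sum_sub_distrib] at h3
    have e3 : ∑ j, θ j * (a * log2 (nj j)) = a * ∑ j, θ j * log2 (nj j) := by
      rw [Finset.mul_sum]; exact Finset.sum_congr rfl fun j _ => by ring
    have e4 : ∑ j, θ j * ((1 - a)⁻¹ * log2 (∑ x, pj j x ^ a)) =
        (1 - a)⁻¹ * ∑ j, θ j * log2 (∑ x, pj j x ^ a) := by
      rw [Finset.mul_sum]; exact Finset.sum_congr rfl fun j _ => by ring
    rw [e3] at h3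
    rw [e4, div_eq_inv_mul, mul_assoc, ← mul_add]
    refine mul_le_mul_of_nonneg_left ?_ (inv_nonneg.2 (by linarith))
    linarith

lemma aux_mix_one (θ : J → ℝ)
    (hθ : ∀ j, 0 ≤ θ j) (hθ1 : ∑ j, θ j = 1) (S : J → Matrix X X ℝ)
    (hS : ∀ j, DoublyStochastic (S j)) (pj : J → X → ℝ) (hpj : ∀ j, IsProbVec (pj j))
    (p : X → ℝ) (hmix : ∀ x, p x = ∑ j, θ j * ∑ x', S j x x' * pj j x') :
    ∑ j, θ j * renyi 1 (pj j) ≤ renyi 1 p := by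
  have h := aux_jensen _ Real.concaveOn_negMulLog θ hθ hθ1 S hS pj (fun j => (hpj j).1)
  simp only [← hmix] at h
  have e : ∀ q : X → ℝ, renyi 1 q = (Real.log 2)⁻¹ * ∑ x, Real.negMulLog (q x) := by
    intro q
    simp only [renyi, one_ne_zero, if_false, if_true, log2, Real.logb, Real.negMulLog]
    rw [← Finset.sum_neg_distrib, Finset.mul_sum]
    exact Finset.sum_congr rfl fun x _ => by ring
  simp only [e]
  have e4 : ∑ j, θ j * ((Real.log 2)⁻¹ * ∑ x, Real.negMulLog (pj j x)) =
      (Real.log 2)⁻¹ * ∑ j, θ j * ∑ x, Real.negMulLog (pj j x) := by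
    rw [Finset.mul_sum]; exact Finset.sum_congr rfl fun j _ => by ring
  rw [e4]
  exact mul_le_mul_of_nonneg_left h (inv_nonneg.2 (Real.log_pos (by norm_num)).le)

/-- The norm of order `α`. -/
def auxN (α : ℝ≥0∞) (p : X → ℝ) : ℝ :=
  if α = ⊤ then ⨆ x, p x else (∑ x, p x ^ α.toReal) ^ (α.toReal)⁻¹

lemma auxN_pos (α : ℝ≥0∞) {p : X → ℝ} (hp : IsProbVec p) : 0 < auxN α p := by
  unfold auxN
  split_ifs with h
  · obtain ⟨x, hx⟩ := aux_exists_pos hp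
    exact hx.trans_le (le_ciSup (Set.finite_range p).bddAbove x)
  · exact Real.rpow_pos_of_pos (aux_sum_rpow_pos hp _) _

lemma aux_renyi_eq (α : ℝ≥0∞) (hα : 1 < α) {p : X → ℝ} (hp : IsProbVec p) :
    renyi α p = aRatio α * log2 (auxN α p) := by
  have h0 : α ≠ 0 := (zero_lt_one.trans hα).ne'
  have h1 : α ≠ 1 := hα.ne'
  by_cases h : α = ⊤
  · subst h; simp [renyi, aRatio, auxN]
  · have ha0 : 0 < α.toReal := ENNReal.toReal_pos h0 h
    simp only [renyi, aRatio, auxN, h0, h1, h, if_false]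
    simp only [log2]
    rw [Real.logb_rpow_eq_mul_logb_of_pos (aux_sum_rpow_pos hp _)]
    field_simp

lemma aux_aRatio_neg (α : ℝ≥0∞) (hα : 1 < α) : aRatio α ≤ 0 := by
  unfold aRatio
  split_ifs with h
  · norm_num
  · have : 1 < α.toReal := by
      simpa using (ENNReal.toReal_lt_toReal ENNReal.one_ne_top h).2 hα
    exact div_nonpos_of_nonneg_of_nonpos (by linarith) (by linarith)

lemma auxN_le (α : ℝ≥0∞) (hα : 1 < α) (θ : J → ℝ)
    (hθ : ∀ j, 0 ≤ θ j) (hθ1 : ∑ j, θ j = 1) (S : J → Matrix X X ℝ)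
    (hS : ∀ j, DoublyStochastic (S j)) (pj : J → X → ℝ) (hpj : ∀ j, IsProbVec (pj j))
    (p : X → ℝ) (hp : IsProbVec p) (n : ℝ) (hn : 0 < n)
    (hmix : ∀ x, p x / n = ∑ j, θ j * ∑ x', S j x x' * (pj j x' / auxN α (pj j))) :
    auxN α p ≤ n := by
  have hnj : ∀ j, 0 < auxN α (pj j) := fun j => auxN_pos α (hpj j)
  have hv : ∀ j x, 0 ≤ pj j x / auxN α (pj j) := fun j x => div_nonneg ((hpj j).1 x) (hnj j).le
  by_cases h : α = ⊤
  · have hle : ∀ x, p x / n ≤ 1 := by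
      intro x
      rw [hmix, ← hθ1]
      refine Finset.sum_le_sum fun j _ => ?_
      refine mul_le_of_le_one_right (hθ j) ?_
      rw [← (hS j).2.1 x]
      refine Finset.sum_le_sum fun x' _ => ?_
      refine mul_le_of_le_one_right ((hS j).1 _ _) ?_
      rw [div_le_one (hnj j)]
      simp only [auxN, h, if_true]
      exact le_ciSup (Set.finite_range (pj j)).bddAbove x'
    obtain ⟨x0, _⟩ := aux_exists_pos hp
    have : Nonempty X := ⟨x0⟩
    simp only [auxN, h, if_true]
    refine ciSup_le fun x => ?_
    have := hle x
    rwa [div_le_one hn] at this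
  · obtain ⟨a, ha⟩ : ∃ a, a = α.toReal := ⟨_, rfl⟩
    have ha1 : 1 < a := by
      rw [ha]; simpa using (ENNReal.toReal_lt_toReal ENNReal.one_ne_top h).2 hα
    have ha0 : 0 < a := by linarith
    have hj := aux_jensen _ (convexOn_rpow ha1.le).neg θ hθ hθ1 S hS _ hv
    simp only [← hmix] at hj
    simp only [Pi.neg_apply, Finset.sum_neg_distrib, mul_neg] at hj
    have hj := neg_le_neg_iff.1 hj
    have e0 : ∀ j, auxN α (pj j) ^ a = ∑ x, pj j x ^ a := by
      intro j
      simp only [auxN, h, if_false, ← ha]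
      rw [← Real.rpow_mul (aux_sum_rpow_pos (hpj j) a).le, inv_mul_cancel₀ ha0.ne', Real.rpow_one]
    have e1 : ∀ j, ∑ x, (pj j x / auxN α (pj j)) ^ a = 1 := by
      intro j
      have : ∀ x, (pj j x / auxN α (pj j)) ^ a = pj j x ^ a / auxN α (pj j) ^ a :=
        fun x => Real.div_rpow ((hpj j).1 x) (hnj j).le _
      simp only [this]
      rw [← Finset.sum_div, e0, div_self (aux_sum_rpow_pos (hpj j) a).ne']
    have e2 : ∑ x, (p x / n) ^ a = (∑ x, p x ^ a) / n ^ a := by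
      rw [Finset.sum_div]
      exact Finset.sum_congr rfl fun x _ => Real.div_rpow (hp.1 x) hn.le _
    simp only [e1, e2, mul_one, hθ1] at hj
    rw [div_le_one (Real.rpow_pos_of_pos hn _)] at hj
    simp only [auxN, h, if_false, ← ha]
    rw [Real.rpow_inv_le_iff_of_pos (aux_sum_rpow_pos hp a).le hn.le ha0]
    exact hj

lemma aux_measurable (p : X → ℝ) : Measurable fun α : ℝ≥0∞ => renyi α p := by
  unfold renyi
  refine Measurable.ite (measurableSet_singleton _) measurable_const ?_
  refine Measurable.ite (measurableSet_singleton _) measurable_const ?_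
  refine Measurable.ite (measurableSet_singleton _) measurable_const ?_
  refine Measurable.mul ?_ ?_
  · exact (measurable_const.sub ENNReal.measurable_toReal).inv
  · unfold log2 Real.logb
    refine Measurable.div_const (Real.measurable_log.comp ?_) _
    refine Finset.measurable_sum _ fun x _ => ?_
    exact measurable_const.pow ENNReal.measurable_toReal

lemma aux_bound {p : X → ℝ} (hp : IsProbVec p) (α : ℝ≥0∞) (h0 : α ≠ 0) (hα : α < 1) :
    |renyi α p| ≤ log2 (Fintype.card X) := by
  have htop : α ≠ ⊤ := (hα.trans ENNReal.one_lt_top).ne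
  have h1 : α ≠ 1 := hα.ne
  simp only [renyi, h0, h1, htop, if_false]
  obtain ⟨a, ha⟩ : ∃ a, a = α.toReal := ⟨_, rfl⟩
  have ha0 : 0 < a := ha ▸ ENNReal.toReal_pos h0 htop
  have ha1 : a < 1 := by
    rw [ha]; simpa using (ENNReal.toReal_lt_toReal htop ENNReal.one_ne_top).2 hα
  rw [← ha]
  obtain ⟨x0, _⟩ := aux_exists_pos hp
  have : Nonempty X := ⟨x0⟩
  have hm : (0:ℝ) < Fintype.card X := by exact_mod_cast Fintype.card_pos
  have hlow : 1 ≤ ∑ x, p x ^ a := by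
    rw [← hp.2]
    refine Finset.sum_le_sum fun x _ => ?_
    exact Real.self_le_rpow_of_le_one (hp.1 x) (aux_le_one hp x) ha1.le
  have hup : ∑ x, p x ^ a ≤ (Fintype.card X : ℝ) ^ (1 - a) := by
    have := (Real.concaveOn_rpow ha0.le ha1.le).le_map_sum (t := Finset.univ)
      (w := fun _ : X => (Fintype.card X : ℝ)⁻¹) (p := p) (fun _ _ => by positivity)
      (by simp) (fun x _ => hp.1 x)
    simp only [smul_eq_mul, ← Finset.mul_sum, hp.2, mul_one] at this
    rw [inv_mul_le_iff₀ hm, Real.inv_rpow hm.le] at this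
    rwa [Real.rpow_sub hm, Real.rpow_one, div_eq_mul_inv]
  have hl0 : 0 ≤ log2 (∑ x, p x ^ a) := Real.logb_nonneg (by norm_num) hlow
  have hl1 : log2 (∑ x, p x ^ a) ≤ (1 - a) * log2 (Fintype.card X) := by
    refine (aux_log2_mono (by linarith) hup).trans (le_of_eq ?_)
    simp only [log2]
    rw [Real.logb_rpow_eq_mul_logb_of_pos hm]
  have h1a : 0 < 1 - a := by linarith
  rw [abs_of_nonneg (mul_nonneg (inv_nonneg.2 h1a.le) hl0), inv_mul_le_iff₀ h1a]
  exact hl1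

lemma aux_integrable (τ : Measure ℝ≥0∞) [IsProbabilityMeasure τ] (αs : ℝ≥0∞)
    (hτ : ∀ᵐ α ∂τ, α ≤ 1 ∨ α = αs) {p : X → ℝ} (hp : IsProbVec p) :
    Integrable (fun α => renyi α p) τ := by
  refine Integrable.of_bound (aux_measurable p).aestronglyMeasurable
    (max (max |renyi 0 p| |renyi 1 p|) (max |renyi αs p| (log2 (Fintype.card X)))) ?_
  filter_upwards [hτ] with α hα
  rw [Real.norm_eq_abs]
  by_cases h0 : α = 0
  · subst h0; simp
  by_cases h1 : α = 1
  · subst h1; simp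
  rcases hα with h | h
  · have := aux_bound hp α h0 (lt_of_le_of_ne h h1)
    exact this.trans ((le_max_right _ _).trans (le_max_right _ _))
  · subst h; simp

lemma aux_integrate (τ : Measure ℝ≥0∞) [IsProbabilityMeasure τ] (αs : ℝ≥0∞)
    (hτ : ∀ᵐ α ∂τ, α ≤ 1 ∨ α = αs) (θ : J → ℝ)
    (pj : J → X → ℝ) (hpj : ∀ j, IsProbVec (pj j)) (p : X → ℝ) (hp : IsProbVec p)
    (r : ℝ≥0∞ → ℝ) (hr : Integrable r τ) (hr0 : 0 ≤ ∫ α, r α ∂τ)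
    (h : ∀ᵐ α ∂τ, ∑ j, θ j * renyi α (pj j) + r α ≤ renyi α p) :
    ∑ j, θ j * ∫ α, renyi α (pj j) ∂τ ≤ ∫ α, renyi α p ∂τ := by
  have hi : ∀ j, Integrable (fun α => θ j * renyi α (pj j)) τ := fun j =>
    (aux_integrable τ αs hτ (hpj j)).const_mul _
  have hs : Integrable (fun α => ∑ j, θ j * renyi α (pj j)) τ :=
    integrable_finsetSum _ fun j _ => hi j
  have := integral_mono_ae (hs.add hr) (aux_integrable τ αs hτ hp) h
  simp only [Pi.add_apply] at this
  rw [integral_add hs hr, integral_finsetSum _ fun j _ => hi j] at this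
  simp only [integral_const_mul] at this
  linarith

lemma aux_main (τ : Measure ℝ≥0∞) [IsProbabilityMeasure τ]
    (hτ : τ {α | 1 < α} = 0 ∨
      (∃ αstar : ℝ≥0∞, 1 < αstar ∧ τ {α | 1 < α ∧ α ≠ αstar} = 0 ∧ τ {1} = 0 ∧
        Integrable aRatio τ ∧ ∫ α, aRatio α ∂τ ≤ 0))
    (w : J → ℝ) (hw : ∀ j, 0 ≤ w j) (hw1 : ∑ j, w j = 1) (S : J → Matrix X X ℝ)
    (hS : ∀ j, DoublyStochastic (S j)) (pj : J → X → ℝ) (hpj : ∀ j, IsProbVec (pj j))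
    (p : X → ℝ) (hp : IsProbVec p)
    (hmix : ∀ x, p x = ∑ j, w j * ∑ x', S j x x' * pj j x') :
    ∃ θ : J → ℝ, (∀ j, 0 ≤ θ j) ∧ ∑ j, θ j = 1 ∧
      ∑ j, θ j * ∫ α, renyi α (pj j) ∂τ ≤ ∫ α, renyi α p ∂τ := by
  rcases hτ with hτ | ⟨αs, hαs, hsupp, hone, hint, hle⟩
  · refine ⟨w, hw, hw1, ?_⟩
    have hae : ∀ᵐ α ∂τ, α ≤ 1 := by
      rw [ae_iff]; simpa using hτ
    refine aux_integrate τ 0 (hae.mono fun α h => Or.inl h) w pj hpj p hp (fun _ => 0)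
      (integrable_zero _ _ _) (by simp) ?_
    filter_upwards [hae] with α hα
    rcases hα.lt_or_eq with h | h
    · have := aux_mix_lt_one α h w hw hw1 S hS pj hpj p hp 1 one_pos (fun _ => 1)
        (fun _ => one_pos) (by simpa using hmix)
      simpa [log2] using this
    · subst h
      simpa using aux_mix_one w hw hw1 S hS pj hpj p hmix
  · have hnj : ∀ j, 0 < auxN αs (pj j) := fun j => auxN_pos αs (hpj j)
    obtain ⟨j0, hj0⟩ := aux_exists_pos (p := w) ⟨hw, hw1⟩
    obtain ⟨n, hn⟩ : ∃ n, n = ∑ j, w j * auxN αs (pj j) := ⟨_, rfl⟩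
    have hnpos : 0 < n := by
      rw [hn]
      exact Finset.sum_pos' (fun j _ => mul_nonneg (hw j) (hnj j).le)
        ⟨j0, Finset.mem_univ _, mul_pos hj0 (hnj j0)⟩
    obtain ⟨θ, hθdef⟩ : ∃ θ : J → ℝ, ∀ j, θ j = w j * auxN αs (pj j) / n := ⟨_, fun _ => rfl⟩
    have hθ : ∀ j, 0 ≤ θ j := fun j => by
      rw [hθdef]; exact div_nonneg (mul_nonneg (hw j) (hnj j).le) hnpos.le
    have hθ1 : ∑ j, θ j = 1 := by
      simp only [hθdef]
      rw [← Finset.sum_div, ← hn, div_self hnpos.ne']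
    have hmix' : ∀ x, p x / n = ∑ j, θ j * ∑ x', S j x x' * (pj j x' / auxN αs (pj j)) := by
      intro x
      rw [hmix, Finset.sum_div]
      refine Finset.sum_congr rfl fun j _ => ?_
      simp only [← mul_div_assoc, ← Finset.sum_div, hθdef]
      have := (hnj j).ne'
      field_simp
    refine ⟨θ, hθ, hθ1, ?_⟩
    have hK : log2 n - ∑ j, θ j * log2 (auxN αs (pj j)) ≤ 0 := by
      have h := aux_logJensen θ hθ hθ1 (fun j => (auxN αs (pj j))⁻¹) (fun j => inv_pos.2 (hnj j))
      have e : ∑ j, θ j * (auxN αs (pj j))⁻¹ = n⁻¹ := by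
        have : ∀ j, θ j * (auxN αs (pj j))⁻¹ = w j * n⁻¹ := by
          intro j
          rw [hθdef]
          have := (hnj j).ne'
          field_simp
        simp only [this]
        rw [← Finset.sum_mul, hw1, one_mul]
      rw [e] at h
      simp only [log2, Real.logb_inv, mul_neg, Finset.sum_neg_distrib] at h ⊢
      linarith
    have hae : ∀ᵐ α ∂τ, α ≤ 1 ∨ α = αs := by
      rw [ae_iff]
      convert hsupp using 3
      ext α
      simp
    have hae1 : ∀ᵐ α ∂τ, α ≠ 1 := by
      rw [ae_iff]; simpa using hone
    refine aux_integrate τ αs hae θ pj hpj p hp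
      (fun α => aRatio α * (log2 n - ∑ j, θ j * log2 (auxN αs (pj j))))
      (hint.mul_const _) ?_ ?_
    · rw [integral_mul_const]
      exact mul_nonneg_of_nonpos_of_nonpos hle hK
    · filter_upwards [hae, hae1] with α h h1
      rcases h with h | h
      · exact aux_mix_lt_one α (lt_of_le_of_ne h h1) θ hθ hθ1 S hS pj hpj p hp n hnpos _ hnj hmix'
      · subst h
        have hN := auxN_le α hαs θ hθ hθ1 S hS pj hpj p hp n hnpos hmix'
        have hl := aux_log2_mono (auxN_pos α hp) hN
        rw [aux_renyi_eq α hαs hp]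
        have e : ∑ j, θ j * renyi α (pj j) = aRatio α * ∑ j, θ j * log2 (auxN α (pj j)) := by
          rw [Finset.mul_sum]
          refine Finset.sum_congr rfl fun j _ => ?_
          rw [aux_renyi_eq α hαs (hpj j)]; ring
        rw [e, ← mul_add, add_sub_cancel]
        exact mul_le_mul_of_nonpos_left hl (aux_aRatio_neg α hαs)

end Helpers

lemma aux_cond_prob {X Y : Type} [Fintype X] [Fintype Y] {P : Matrix X Y ℝ} (hP : IsJointProb P)
    {y : Y} (hy : 0 < margY P y) : IsProbVec (condX P y) := by
  refine ⟨fun x => div_nonneg (hP.1 x y) hy.le, ?_⟩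
  simp only [condX]
  rw [← Finset.sum_div]
  exact div_self hy.ne'

lemma aux_exists_marg {X Y : Type} [Fintype X] [Fintype Y] {P : Matrix X Y ℝ}
    (hP : IsJointProb P) : ∃ y, 0 < margY P y := by
  by_contra! h
  have h1 : ∑ y, ∑ x, P x y = 1 := Finset.sum_comm.trans hP.2
  have : ∑ y, margY P y ≤ 0 := Finset.sum_nonpos fun y _ => h y
  simp only [margY] at this
  linarith

/-- Monotonicity of `H_{-∞,τ}` under conditionally mixing channels for
probability measures `τ` supported in `[0,1]`, or in `[0,1] ∪ {α*}` with `α* ∈ (1,∞]`,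
`τ({1}) = 0` and `∫ α/(1-α) dτ(α) ≤ 0` (with `α/(1-α) = -1` at `α = ∞`). -/
theorem HnegInf_monotone (τ : Measure ℝ≥0∞) (hprob : IsProbabilityMeasure τ)
    (hτ : τ {α | 1 < α} = 0 ∨
      (∃ αstar : ℝ≥0∞, 1 < αstar ∧ τ {α | 1 < α ∧ α ≠ αstar} = 0 ∧ τ {1} = 0 ∧
        Integrable aRatio τ ∧ ∫ α, aRatio α ∂τ ≤ 0)) :
    ∀ (X Y Y' : Type) [Fintype X] [Fintype Y] [Fintype Y']
      (P : Matrix X Y ℝ) (Q : Matrix X Y' ℝ),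
      IsJointProb P → IsJointProb Q → CondMixed P Q →
      HnegInf τ P ≤ HnegInf τ Q := by
  intro X Y Y' _ _ _ P Q hP hQ hPQ
  classical
  obtain ⟨k, S, D, hS, hD, hD1, hQe⟩ := hPQ
  obtain ⟨y0, hy0⟩ := aux_exists_marg hQ
  have hQx : ∀ x y', Q x y' = ∑ i, ∑ y : {y // 0 < margY P y},
      D i y y' * ∑ x', S i x x' * P x' y := by
    intro x y'
    rw [hQe, Matrix.sum_apply]
    refine Finset.sum_congr rfl fun i _ => ?_
    rw [Matrix.mul_apply]
    have hz : ∀ y, ¬ 0 < margY P y → (S i * P) x y * D i y y' = 0 := by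
      intro y hy
      have h0 : margY P y = 0 :=
        le_antisymm (not_lt.1 hy) (Finset.sum_nonneg fun x _ => hP.1 x y)
      have h1 : ∀ x', P x' y = 0 := fun x' =>
        (Finset.sum_eq_zero_iff_of_nonneg (fun x _ => hP.1 x y)).1 h0 x' (Finset.mem_univ _)
      simp [Matrix.mul_apply, h1]
    rw [← Finset.sum_filter_of_ne (p := fun y => 0 < margY P y)
      (fun y _ hne => by by_contra hc; exact hne (hz y hc)),
      ← Finset.sum_subtype_eq_sum_filter, Finset.subtype_univ]
    refine Finset.sum_congr rfl fun y _ => ?_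
    rw [Matrix.mul_apply, mul_comm]
  refine le_csInf ⟨_, ⟨y0, hy0, rfl⟩⟩ ?_
  rintro _ ⟨y', hy', rfl⟩
  simp only [Set.mem_ofPred_eq] at hy'
  have hPe : ∀ x (y : {y // 0 < margY P y}), P x y = margY P y * condX P y x := by
    intro x y
    rw [condX, mul_div_cancel₀ _ y.2.ne']
  have hPs : ∀ y : {y // 0 < margY P y}, IsProbVec (condX P y.1) := fun y => aux_cond_prob hP y.2
  obtain ⟨θ, hθ, hθ1, hle⟩ := aux_main τ hτ
    (J := Fin k × {y // 0 < margY P y})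
    (fun j => D j.1 j.2 y' * margY P j.2 / margY Q y')
    (fun j => div_nonneg (mul_nonneg (hD _ _ _) j.2.2.le) hy'.le)
    (by
      rw [← Finset.sum_div, div_eq_one_iff_eq hy'.ne', Fintype.sum_prod_type]
      conv_rhs => rw [margY]
      simp only [hQx]
      conv_rhs => rw [Finset.sum_comm]
      refine Finset.sum_congr rfl fun i _ => ?_
      rw [Finset.sum_comm]
      refine Finset.sum_congr rfl fun y _ => ?_
      rw [← Finset.mul_sum, Finset.sum_comm]
      simp only [← Finset.sum_mul, (hS i).2.2, one_mul]
      rfl)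
    (fun j => S j.1) (fun j => hS j.1) (fun j => condX P j.2) (fun j => hPs j.2)
    (condX Q y') (aux_cond_prob hQ hy')
    (by
      intro x
      rw [condX, hQx, Finset.sum_div, Fintype.sum_prod_type]
      refine Finset.sum_congr rfl fun i _ => ?_
      rw [Finset.sum_div]
      refine Finset.sum_congr rfl fun y _ => ?_
      simp only [hPe, mul_left_comm _ (margY P y.1), ← Finset.mul_sum]
      ring)
  refine le_trans ?_ hle
  have hb : ∀ j : Fin k × {y // 0 < margY P y},
      HnegInf τ P ≤ ∫ α, renyi α (condX P j.2.1) ∂τ := fun j =>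
    csInf_le (Set.toFinite _).bddBelow ⟨j.2.1, j.2.2, rfl⟩
  calc HnegInf τ P = ∑ j, θ j * HnegInf τ P := by rw [← Finset.sum_mul, hθ1, one_mul]
    _ ≤ _ := Finset.sum_le_sum fun j _ => mul_le_mul_of_nonneg_left (hb j) (hθ j)
end
end
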